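/- arXiv:1702.05973 — 5 statements merged into one kernel-verified Lean document; each statement's English description precedes it below -/
import Mathlib

section
/- For t > 0 and x, y ∈ ℝ⁴, let k_t(x,y) = (4πt)^{−2} exp(−‖x−y‖²/(4t)) be the scalar heat kernel on ℝ⁴. Fix L > 0, indices i, j, k ∈ {1,2,3,4}, and a smooth compactly supported function φ : ℝ⁴ × ℝ⁴ → ℝ. For 0 < ε < L define I(ε) = ∫_{ℝ⁴×ℝ⁴} ∫_{[ε,L]²} φ(x,y) · t₂ · (∂k_{t₁}/∂x^i)(x,y) (∂²k_{t₂}/∂x^j∂x^k)(x,y) dt₁ dt₂ dx dy. Then I(ε) − A·log ε converges to a finite limit as ε → 0⁺, where A = (1/(192π²)) ( δ_{ij} ∫_{ℝ⁴} (∂φ/∂x^k)(x,x) dx + δ_{ik} ∫_{ℝ⁴} (∂φ/∂x^j)(x,x) dx − 2 δ_{jk} ∫_{ℝ⁴} (∂φ/∂x^i)(x,x) dx ). -/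
open MeasureTheory Filter Topology

/-- The spatial derivative `∂k_t/∂x^i` of the scalar heat kernel
`k_t(x,y) = (4πt)⁻² exp(-‖x-y‖²/(4t))` on `ℝ⁴`. -/
noncomputable def heatKernelDx (i : Fin 4) (t : ℝ)
    (x y : EuclideanSpace ℝ (Fin 4)) : ℝ :=
  -(1 / (4 * Real.pi) ^ 2) * ((x i - y i) / (2 * t ^ 3)) *
    Real.exp (-‖x - y‖ ^ 2 / (4 * t))

/-- The second spatial derivative `∂²k_t/∂x^a∂x^b` of the scalar heat kernel on `ℝ⁴`. -/
noncomputable def heatKernelDxx (a b : Fin 4) (t : ℝ)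
    (x y : EuclideanSpace ℝ (Fin 4)) : ℝ :=
  (1 / (4 * Real.pi) ^ 2) *
    (-(if a = b then (1 : ℝ) else 0) / (2 * t ^ 3) +
      (x a - y a) * (x b - y b) / (4 * t ^ 4)) *
    Real.exp (-‖x - y‖ ^ 2 / (4 * t))

section Gaussian

variable {V : Type*} [NormedAddCommGroup V]

theorem pow_le_const_mul_exp_half_sq (n : ℕ) (r : ℝ) :
    r ^ n ≤ (1 + 2 ^ n * n.factorial) * Real.exp (r ^ 2 / 2) := by
  have h1 : (1 : ℝ) ≤ Real.exp (r ^ 2 / 2) := Real.one_le_exp (by positivity)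
  have h2 := Real.pow_div_factorial_le_exp (r ^ 2 / 2) (by positivity) n
  rw [div_le_iff₀ (by positivity), div_pow, div_le_iff₀ (by positivity)] at h2
  have h3 : r ^ n ≤ 1 + (r ^ 2) ^ n := by
    rw [← pow_mul, mul_comm, pow_mul]
    nlinarith [sq_nonneg (r ^ n - 1)]
  linarith

theorem norm_pow_mul_exp_neg_mul_sq_le (n : ℕ) {b : ℝ} (hb : 0 < b) (z : V) :
    ‖z‖ ^ n * Real.exp (-b * ‖z‖ ^ 2) ≤
      (1 + 2 ^ n * n.factorial) * (√b)⁻¹ ^ n * Real.exp (-(b / 2) * ‖z‖ ^ 2) := by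
  have hs : 0 < √b := Real.sqrt_pos.2 hb
  have h := pow_le_const_mul_exp_half_sq n (√b * ‖z‖)
  have hexp : Real.exp ((√b * ‖z‖) ^ 2 / 2) * Real.exp (-b * ‖z‖ ^ 2) =
      Real.exp (-(b / 2) * ‖z‖ ^ 2) := by
    rw [← Real.exp_add, mul_pow, Real.sq_sqrt hb.le]
    ring_nf
  calc ‖z‖ ^ n * Real.exp (-b * ‖z‖ ^ 2)
      = (√b)⁻¹ ^ n * ((√b * ‖z‖) ^ n * Real.exp (-b * ‖z‖ ^ 2)) := by
        rw [mul_pow, inv_pow]; field_simp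
    _ ≤ (√b)⁻¹ ^ n * ((1 + 2 ^ n * n.factorial) * Real.exp ((√b * ‖z‖) ^ 2 / 2) *
          Real.exp (-b * ‖z‖ ^ 2)) := by gcongr
    _ = _ := by rw [mul_assoc (1 + _ : ℝ), hexp]; ring

variable [InnerProductSpace ℝ V]

theorem hasFDerivAt_exp_neg_mul_sq_norm (b : ℝ) (z : V) :
    HasFDerivAt (fun z : V => Real.exp (-b * ‖z‖ ^ 2))
      (Real.exp (-b * ‖z‖ ^ 2) • (-b) • (2 : ℕ) • innerSL ℝ z) z :=
  ((hasStrictFDerivAt_norm_sq z).hasFDerivAt.const_mul (-b)).exp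

variable [FiniteDimensional ℝ V] [MeasurableSpace V] [BorelSpace V]

theorem integrable_exp_neg_mul_sq_norm {b : ℝ} (hb : 0 < b) :
    Integrable fun z : V => Real.exp (-b * ‖z‖ ^ 2) := by
  by_contra h
  have h0 := integral_undef h
  rw [GaussianFourier.integral_rexp_neg_mul_sq_norm hb] at h0
  exact (Real.rpow_pos_of_pos (by positivity) _).ne' h0

theorem integrable_norm_pow_mul_exp_neg_mul_sq (n : ℕ) {b : ℝ} (hb : 0 < b) :
    Integrable fun z : V => ‖z‖ ^ n * Real.exp (-b * ‖z‖ ^ 2) := by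
  refine ((integrable_exp_neg_mul_sq_norm (V := V) (half_pos hb)).const_mul
    ((1 + 2 ^ n * n.factorial) * (√b)⁻¹ ^ n)).mono' (by fun_prop) (.of_forall fun z => ?_)
  rw [Real.norm_of_nonneg (by positivity)]
  exact norm_pow_mul_exp_neg_mul_sq_le n hb z

theorem integrable_mul_exp_neg_mul_sq_norm {f : V → ℝ} (hf : Continuous f) (n : ℕ) {C : ℝ}
    (hfn : ∀ z, |f z| ≤ C * ‖z‖ ^ n) {b : ℝ} (hb : 0 < b) :
    Integrable fun z : V => f z * Real.exp (-b * ‖z‖ ^ 2) := by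
  refine ((integrable_norm_pow_mul_exp_neg_mul_sq (V := V) n hb).const_mul C).mono'
    (by fun_prop) (.of_forall fun z => ?_)
  rw [norm_mul, Real.norm_eq_abs, Real.norm_of_nonneg (Real.exp_nonneg _), ← mul_assoc]
  gcongr
  exact hfn z

/-- Gaussian integration by parts. -/
theorem integral_inner_mul_exp_neg_mul_sq_norm {b : ℝ} (hb : 0 < b) {f : V → ℝ}
    (hf : Differentiable ℝ f) (v : V)
    (h1 : Integrable fun z => fderiv ℝ f z v * Real.exp (-b * ‖z‖ ^ 2))
    (h2 : Integrable fun z => inner ℝ z v * f z * Real.exp (-b * ‖z‖ ^ 2))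
    (h3 : Integrable fun z => f z * Real.exp (-b * ‖z‖ ^ 2)) :
    ∫ z, inner ℝ z v * f z * Real.exp (-b * ‖z‖ ^ 2) =
      1 / (2 * b) * ∫ z, fderiv ℝ f z v * Real.exp (-b * ‖z‖ ^ 2) := by
  have hd (z : V) : f z * fderiv ℝ (fun z : V => Real.exp (-b * ‖z‖ ^ 2)) z v =
      -(2 * b) * (inner ℝ z v * f z * Real.exp (-b * ‖z‖ ^ 2)) := by
    rw [(hasFDerivAt_exp_neg_mul_sq_norm b z).fderiv]
    simp
    ring
  have h := integral_mul_fderiv_eq_neg_fderiv_mul_of_integrable (μ := volume) h1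
    (by simpa only [hd] using h2.const_mul _) h3 (fun x _ => hf x)
    (fun x _ => (hasFDerivAt_exp_neg_mul_sq_norm b x).differentiableAt)
  simp only [hd, integral_const_mul] at h
  rw [eq_comm, one_div, inv_mul_eq_iff_eq_mul₀ (by positivity)]
  linarith

end Gaussian

section Moments

local notation "E4" => EuclideanSpace ℝ (Fin 4)

theorem abs_euclideanSpace_apply_le {ι : Type*} [Fintype ι] (z : EuclideanSpace ℝ ι) (i : ι) :
    |z i| ≤ ‖z‖ :=
  PiLp.norm_apply_le z i

theorem hasFDerivAt_coord {ι : Type*} [Fintype ι] (i : ι) (z : EuclideanSpace ℝ ι) :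
    HasFDerivAt (fun z : EuclideanSpace ℝ ι => z i)
      (EuclideanSpace.proj i : EuclideanSpace ℝ ι →L[ℝ] ℝ) z :=
  (EuclideanSpace.proj i : EuclideanSpace ℝ ι →L[ℝ] ℝ).hasFDerivAt

theorem integral_exp_neg_mul_sq_norm_four {b : ℝ} (hb : 0 < b) :
    ∫ z : E4, Real.exp (-b * ‖z‖ ^ 2) = (Real.pi / b) ^ 2 := by
  rw [GaussianFourier.integral_rexp_neg_mul_sq_norm hb, ← Real.rpow_natCast]
  norm_num

theorem integral_coord_mul_coord_mul_exp {b : ℝ} (hb : 0 < b) (i j : Fin 4) :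
    ∫ z : E4, z i * z j * Real.exp (-b * ‖z‖ ^ 2) =
      1 / (2 * b) * (if i = j then 1 else 0) * (Real.pi / b) ^ 2 := by
  have hfd (z : E4) : fderiv ℝ (fun z : E4 => z j) z (EuclideanSpace.single i 1) =
      if i = j then 1 else 0 := by
    rw [(hasFDerivAt_coord j z).fderiv]
    simp [eq_comm]
  have h := integral_inner_mul_exp_neg_mul_sq_norm hb (f := fun z : E4 => z j) (by fun_prop)
    (EuclideanSpace.single i 1)
    (by simpa only [hfd] using (integrable_exp_neg_mul_sq_norm hb).const_mul _)
    (integrable_mul_exp_neg_mul_sq_norm (by fun_prop) 2 (C := 1) (fun z => by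
      simp only [EuclideanSpace.inner_single_right, one_mul, abs_mul, conj_trivial, sq]
      gcongr <;> apply abs_euclideanSpace_apply_le) hb)
    (integrable_mul_exp_neg_mul_sq_norm (by fun_prop) 1 (C := 1) (fun z => by
      simpa using abs_euclideanSpace_apply_le z j) hb)
  simp only [hfd, integral_const_mul, integral_exp_neg_mul_sq_norm_four hb,
    EuclideanSpace.inner_single_right, one_mul, conj_trivial] at h
  simpa [mul_assoc] using h

theorem integral_coord_mul_coord_mul_coord_mul_coord_mul_exp {b : ℝ} (hb : 0 < b)
    (i j k l : Fin 4) :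
    ∫ z : E4, z i * (z j * z k * z l) * Real.exp (-b * ‖z‖ ^ 2) =
      (1 / (2 * b)) ^ 2 * ((if i = j then 1 else 0) * (if k = l then 1 else 0) +
        (if i = k then 1 else 0) * (if j = l then 1 else 0) +
        (if i = l then 1 else 0) * (if j = k then 1 else 0)) * (Real.pi / b) ^ 2 := by
  have hfd (z : E4) : fderiv ℝ (fun z : E4 => z j * z k * z l) z (EuclideanSpace.single i 1) =
      (if i = j then 1 else 0) * (z k * z l) + (if i = k then 1 else 0) * (z j * z l) +
      (if i = l then 1 else 0) * (z j * z k) := by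
    rw [(((hasFDerivAt_coord j z).fun_mul (hasFDerivAt_coord k z)).fun_mul
      (hasFDerivAt_coord l z)).fderiv]
    simp [eq_comm (a := i)]
    ring_nf
  have hint (m n : Fin 4) :
      Integrable fun z : E4 => z m * z n * Real.exp (-b * ‖z‖ ^ 2) :=
    integrable_mul_exp_neg_mul_sq_norm (by fun_prop) 2 (C := 1) (fun z => by
      simp only [one_mul, abs_mul, sq]
      gcongr <;> apply abs_euclideanSpace_apply_le) hb
  have hexpand (z : E4) : ((if i = j then 1 else 0) * (z k * z l) +
      (if i = k then 1 else 0) * (z j * z l) + (if i = l then 1 else 0) * (z j * z k)) *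
        Real.exp (-b * ‖z‖ ^ 2) =
      (if i = j then 1 else 0) * (z k * z l * Real.exp (-b * ‖z‖ ^ 2)) +
      (if i = k then 1 else 0) * (z j * z l * Real.exp (-b * ‖z‖ ^ 2)) +
      (if i = l then 1 else 0) * (z j * z k * Real.exp (-b * ‖z‖ ^ 2)) := by ring
  have h := integral_inner_mul_exp_neg_mul_sq_norm hb (f := fun z : E4 => z j * z k * z l)
    (by fun_prop) (EuclideanSpace.single i 1)
    (by
      simp only [hfd, hexpand]
      exact (((hint k l).const_mul _).add ((hint j l).const_mul _)).add ((hint j k).const_mul _))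
    (integrable_mul_exp_neg_mul_sq_norm (by fun_prop) 4 (C := 1) (fun z => by
      simp only [EuclideanSpace.inner_single_right, one_mul, abs_mul, conj_trivial,
        show ‖z‖ ^ 4 = ‖z‖ * (‖z‖ * ‖z‖ * ‖z‖) by ring]
      gcongr <;> apply abs_euclideanSpace_apply_le) hb)
    (integrable_mul_exp_neg_mul_sq_norm (by fun_prop) 3 (C := 1) (fun z => by
      simp only [one_mul, abs_mul, show ‖z‖ ^ 3 = ‖z‖ * ‖z‖ * ‖z‖ by ring]
      gcongr <;> apply abs_euclideanSpace_apply_le) hb)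
  simp only [hfd, hexpand] at h
  rw [integral_add (((hint k l).const_mul _).fun_add ((hint j l).const_mul _))
      ((hint j k).const_mul _), integral_add ((hint k l).const_mul _) ((hint j l).const_mul _)] at h
  simp only [integral_const_mul, integral_coord_mul_coord_mul_exp hb] at h
  simp only [EuclideanSpace.inner_single_right, one_mul, conj_trivial] at h
  rw [h]
  ring

end Moments

section LoopKernel

local notation "E4" => EuclideanSpace ℝ (Fin 4)

/-- The product `t₂ · ∂ᵢk_{t₁} · ∂ⱼ∂ₖk_{t₂}` as a function of `z = x - y`. -/
noncomputable def loopKernel (i j k : Fin 4) (t : ℝ × ℝ) (z : EuclideanSpace ℝ (Fin 4)) : ℝ :=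
  t.2 * heatKernelDx i t.1 z 0 * heatKernelDxx j k t.2 z 0

/-- The first moment in the `l`-th coordinate of `loopKernel`. -/
noncomputable def loopMoment (i j k l : Fin 4) (t : ℝ × ℝ) : ℝ :=
  1 / (32 * Real.pi ^ 2) *
    ((if j = k then 1 else 0) * (if i = l then 1 else 0) * (t.2 / (t.1 + t.2) ^ 3) -
      ((if i = j then 1 else 0) * (if k = l then 1 else 0) +
        (if i = k then 1 else 0) * (if j = l then 1 else 0) +
        (if i = l then 1 else 0) * (if j = k then 1 else 0)) * (t.1 * t.2 / (t.1 + t.2) ^ 4))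

variable (i j k : Fin 4)

theorem loopKernel_sub (t : ℝ × ℝ) (x y : E4) :
    loopKernel i j k t (x - y) =
      t.2 * heatKernelDx i t.1 x y * heatKernelDxx j k t.2 x y := by
  simp [loopKernel, heatKernelDx, heatKernelDxx]

theorem continuous_loopKernel (t : ℝ × ℝ) : Continuous (loopKernel i j k t) := by
  unfold loopKernel heatKernelDx heatKernelDxx
  fun_prop

theorem measurable_loopKernel :
    Measurable fun q : (ℝ × ℝ) × E4 => loopKernel i j k q.1 q.2 := by
  unfold loopKernel heatKernelDx heatKernelDxx
  fun_prop

theorem continuousOn_loopKernel :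
    ContinuousOn (fun q : (ℝ × ℝ) × E4 => loopKernel i j k q.1 q.2)
      {q | 0 < q.1.1 ∧ 0 < q.1.2} := by
  unfold loopKernel heatKernelDx heatKernelDxx
  fun_prop (disch := rintro q ⟨h1, h2⟩; positivity)

theorem loopKernel_eq {t : ℝ × ℝ} (h1 : 0 < t.1) (h2 : 0 < t.2) (z : E4) :
    loopKernel i j k t z = 1 / (4 * Real.pi) ^ 4 *
      ((if j = k then 1 else 0) / (4 * t.1 ^ 3 * t.2 ^ 2) * z i -
        1 / (8 * t.1 ^ 3 * t.2 ^ 3) * (z i * z j * z k)) *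
      Real.exp (-((t.1 + t.2) / (4 * t.1 * t.2)) * ‖z‖ ^ 2) := by
  have he : Real.exp (-((t.1 + t.2) / (4 * t.1 * t.2)) * ‖z‖ ^ 2) =
      Real.exp (-‖z‖ ^ 2 / (4 * t.1)) * Real.exp (-‖z‖ ^ 2 / (4 * t.2)) := by
    rw [← Real.exp_add]
    congr 1
    field_simp
    ring
  rw [he]
  simp only [loopKernel, heatKernelDx, heatKernelDxx, sub_zero, PiLp.zero_apply]
  field_simp
  ring

theorem loopKernel_neg (t : ℝ × ℝ) (z : E4) :
    loopKernel i j k t (-z) = -loopKernel i j k t z := by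
  simp [loopKernel, heatKernelDx, heatKernelDxx, neg_div]

theorem integral_loopKernel (t : ℝ × ℝ) : ∫ z, loopKernel i j k t z = 0 := by
  have h := integral_neg_eq_self (loopKernel i j k t) volume
  simp only [loopKernel_neg, integral_neg] at h
  linarith

theorem norm_pow_mul_abs_loopKernel_le (n : ℕ) {t : ℝ × ℝ} (h1 : 0 < t.1) (h2 : 0 < t.2) (z : E4) :
    ‖z‖ ^ n * |loopKernel i j k t z| ≤
      1 / (t.1 ^ 3 * t.2 ^ 2) *
        (‖z‖ ^ (n + 1) * Real.exp (-((t.1 + t.2) / (4 * t.1 * t.2)) * ‖z‖ ^ 2)) +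
      1 / (t.1 ^ 3 * t.2 ^ 3) *
        (‖z‖ ^ (n + 3) * Real.exp (-((t.1 + t.2) / (4 * t.1 * t.2)) * ‖z‖ ^ 2)) := by
  have hpi : 1 / (4 * Real.pi) ^ 4 ≤ 1 := by
    rw [div_le_one (by positivity)]
    exact one_le_pow₀ (by linarith [Real.pi_gt_three])
  have hlin : |(if j = k then 1 else 0) / (4 * t.1 ^ 3 * t.2 ^ 2) * z i| ≤
      1 / (t.1 ^ 3 * t.2 ^ 2) * ‖z‖ := by
    have hle : t.1 ^ 3 * t.2 ^ 2 ≤ 4 * t.1 ^ 3 * t.2 ^ 2 := by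
      nlinarith [show 0 < t.1 ^ 3 * t.2 ^ 2 by positivity]
    rw [abs_mul, abs_div, abs_of_pos (by positivity : 0 < 4 * t.1 ^ 3 * t.2 ^ 2)]
    exact mul_le_mul (div_le_div₀ zero_le_one (by split_ifs <;> simp) (by positivity) hle)
      (abs_euclideanSpace_apply_le z i) (abs_nonneg _) (by positivity)
  have hcub : |1 / (8 * t.1 ^ 3 * t.2 ^ 3) * (z i * z j * z k)| ≤
      1 / (t.1 ^ 3 * t.2 ^ 3) * ‖z‖ ^ 3 := by
    have hle : t.1 ^ 3 * t.2 ^ 3 ≤ 8 * t.1 ^ 3 * t.2 ^ 3 := by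
      nlinarith [show 0 < t.1 ^ 3 * t.2 ^ 3 by positivity]
    have hz : |z i * z j * z k| ≤ ‖z‖ ^ 3 := by
      rw [abs_mul, abs_mul, show ‖z‖ ^ 3 = ‖z‖ * ‖z‖ * ‖z‖ by ring]
      gcongr <;> apply abs_euclideanSpace_apply_le
    rw [abs_mul, abs_of_pos (by positivity : 0 < 1 / (8 * t.1 ^ 3 * t.2 ^ 3))]
    exact mul_le_mul (one_div_le_one_div_of_le (by positivity) hle) hz (abs_nonneg _)
      (by positivity)
  rw [loopKernel_eq i j k h1 h2, abs_mul, abs_mul, abs_of_pos (Real.exp_pos _),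
    abs_of_pos (by positivity : 0 < 1 / (4 * Real.pi) ^ 4)]
  calc _ ≤ ‖z‖ ^ n * (1 * (1 / (t.1 ^ 3 * t.2 ^ 2) * ‖z‖ + 1 / (t.1 ^ 3 * t.2 ^ 3) * ‖z‖ ^ 3) *
        Real.exp (-((t.1 + t.2) / (4 * t.1 * t.2)) * ‖z‖ ^ 2)) := by
        gcongr
        exact (abs_sub _ _).trans (add_le_add hlin hcub)
    _ = _ := by ring

theorem integrable_norm_pow_mul_abs_loopKernel (n : ℕ) {t : ℝ × ℝ} (h1 : 0 < t.1) (h2 : 0 < t.2) :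
    Integrable fun z => ‖z‖ ^ n * |loopKernel i j k t z| := by
  have hb : 0 < (t.1 + t.2) / (4 * t.1 * t.2) := by positivity
  have hc := continuous_loopKernel i j k t
  refine (((integrable_norm_pow_mul_exp_neg_mul_sq (n + 1) hb).const_mul
    (1 / (t.1 ^ 3 * t.2 ^ 2))).add ((integrable_norm_pow_mul_exp_neg_mul_sq (n + 3) hb).const_mul
    (1 / (t.1 ^ 3 * t.2 ^ 3)))).mono' (by fun_prop) (.of_forall fun z => ?_)
  rw [Real.norm_of_nonneg (by positivity)]
  exact norm_pow_mul_abs_loopKernel_le i j k n h1 h2 z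

theorem integrable_mul_loopKernel {f : E4 → ℝ} (hf : Continuous f) (n : ℕ) {C : ℝ}
    (hfn : ∀ z, |f z| ≤ C * ‖z‖ ^ n) {t : ℝ × ℝ} (h1 : 0 < t.1) (h2 : 0 < t.2) :
    Integrable fun z => f z * loopKernel i j k t z := by
  have hc := continuous_loopKernel i j k t
  refine ((integrable_norm_pow_mul_abs_loopKernel i j k n h1 h2).const_mul C).mono'
    (by fun_prop) (.of_forall fun z => ?_)
  rw [norm_mul, Real.norm_eq_abs, Real.norm_eq_abs, ← mul_assoc]
  gcongr
  exact hfn z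

theorem integral_coord_mul_loopKernel (l : Fin 4) {t : ℝ × ℝ} (h1 : 0 < t.1) (h2 : 0 < t.2) :
    ∫ z, z l * loopKernel i j k t z = loopMoment i j k l t := by
  have hb : 0 < (t.1 + t.2) / (4 * t.1 * t.2) := by positivity
  have hi2 : Integrable fun z : E4 =>
      z i * z l * Real.exp (-((t.1 + t.2) / (4 * t.1 * t.2)) * ‖z‖ ^ 2) :=
    integrable_mul_exp_neg_mul_sq_norm (by fun_prop) 2 (C := 1) (fun z => by
      simp only [one_mul, abs_mul, sq]
      gcongr <;> apply abs_euclideanSpace_apply_le) hb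
  have hi4 : Integrable fun z : E4 => z i * (z j * z k * z l) *
      Real.exp (-((t.1 + t.2) / (4 * t.1 * t.2)) * ‖z‖ ^ 2) :=
    integrable_mul_exp_neg_mul_sq_norm (by fun_prop) 4 (C := 1) (fun z => by
      simp only [one_mul, abs_mul, show ‖z‖ ^ 4 = ‖z‖ * (‖z‖ * ‖z‖ * ‖z‖) by ring]
      gcongr <;> apply abs_euclideanSpace_apply_le) hb
  have hexpand (z : E4) : z l * loopKernel i j k t z =
      1 / (4 * Real.pi) ^ 4 * ((if j = k then 1 else 0) / (4 * t.1 ^ 3 * t.2 ^ 2)) *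
        (z i * z l * Real.exp (-((t.1 + t.2) / (4 * t.1 * t.2)) * ‖z‖ ^ 2)) -
      1 / (4 * Real.pi) ^ 4 * (1 / (8 * t.1 ^ 3 * t.2 ^ 3)) *
        (z i * (z j * z k * z l) *
          Real.exp (-((t.1 + t.2) / (4 * t.1 * t.2)) * ‖z‖ ^ 2)) := by
    rw [loopKernel_eq i j k h1 h2]
    ring
  simp only [hexpand]
  rw [integral_sub (hi2.const_mul _) (hi4.const_mul _), integral_const_mul, integral_const_mul,
    integral_coord_mul_coord_mul_exp hb, integral_coord_mul_coord_mul_coord_mul_coord_mul_exp hb,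
    loopMoment]
  generalize (if i = j then (1 : ℝ) else 0) = dij
  generalize (if j = k then (1 : ℝ) else 0) = djk
  generalize (if i = k then (1 : ℝ) else 0) = dik
  generalize (if i = l then (1 : ℝ) else 0) = dil
  generalize (if j = l then (1 : ℝ) else 0) = djl
  generalize (if k = l then (1 : ℝ) else 0) = dkl
  field_simp
  ring

theorem inv_sqrt_pow_div_le {s t : ℝ} (hs : 0 < s) (ht : 0 < t) :
    (√((s + t) / (4 * s * t)))⁻¹ ^ 7 / (s ^ 3 * t ^ 2) ≤
        128 * (s ^ (-(3 / 4) : ℝ) * t ^ (-(3 / 4) : ℝ)) ∧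
      (√((s + t) / (4 * s * t)))⁻¹ ^ 9 / (s ^ 3 * t ^ 3) ≤
        512 * (s ^ (-(3 / 4) : ℝ) * t ^ (-(3 / 4) : ℝ)) := by
  obtain ⟨a, ha, rfl⟩ : ∃ a : ℝ, 0 < a ∧ a ^ 4 = s :=
    ⟨s ^ (1 / 4 : ℝ), by positivity, by rw [← Real.rpow_natCast, ← Real.rpow_mul hs.le]; norm_num⟩
  obtain ⟨c, hc, rfl⟩ : ∃ c : ℝ, 0 < c ∧ c ^ 4 = t :=
    ⟨t ^ (1 / 4 : ℝ), by positivity, by rw [← Real.rpow_natCast, ← Real.rpow_mul ht.le]; norm_num⟩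
  have hpow {x : ℝ} (hx : 0 < x) : (x ^ 4) ^ (-(3 / 4) : ℝ) = (x ^ 3)⁻¹ := by
    rw [← Real.rpow_natCast, ← Real.rpow_mul hx.le, ← Real.rpow_natCast, ← Real.rpow_neg hx.le]
    norm_num
  rw [hpow ha, hpow hc]
  set q := (√((a ^ 4 + c ^ 4) / (4 * a ^ 4 * c ^ 4)))⁻¹ with hq
  have hq0 : 0 < q := by positivity
  have hq2 : q ^ 2 = 4 * a ^ 4 * c ^ 4 / (a ^ 4 + c ^ 4) := by
    rw [hq, inv_pow, Real.sq_sqrt (by positivity), inv_div]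
  have hqa : q ≤ 2 * a ^ 2 := by
    refine le_of_sq_le_sq ?_ (by positivity)
    rw [hq2, div_le_iff₀ (by positivity)]
    nlinarith [show 0 < a ^ 8 by positivity]
  have hqc : q ≤ 2 * c ^ 2 := by
    refine le_of_sq_le_sq ?_ (by positivity)
    rw [hq2, div_le_iff₀ (by positivity)]
    nlinarith [show 0 < c ^ 8 by positivity]
  have hqac : q ≤ 2 * (a * c) := by
    refine le_of_sq_le_sq ?_ (by positivity)
    rw [hq2, div_le_iff₀ (by positivity)]
    have : a ^ 2 * c ^ 2 ≤ a ^ 4 + c ^ 4 := by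
      nlinarith [sq_nonneg (a ^ 2 - c ^ 2), sq_nonneg (a ^ 2), sq_nonneg (c ^ 2)]
    nlinarith [mul_le_mul_of_nonneg_left this (by positivity : 0 ≤ 4 * a ^ 2 * c ^ 2)]
  constructor
  · rw [div_le_iff₀ (by positivity)]
    calc q ^ 7 = q ^ 5 * q ^ 2 := by ring
      _ ≤ (2 * (a * c)) ^ 5 * (2 * a ^ 2) ^ 2 := by gcongr
      _ = _ := by field_simp; ring
  · rw [div_le_iff₀ (by positivity)]
    calc q ^ 9 = q ^ 5 * q ^ 2 * q ^ 2 := by ring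
      _ ≤ (2 * (a * c)) ^ 5 * (2 * a ^ 2) ^ 2 * (2 * c ^ 2) ^ 2 := by gcongr
      _ = _ := by field_simp; ring

theorem exists_integral_sq_norm_mul_abs_loopKernel_le :
    ∃ C : ℝ, 0 ≤ C ∧ ∀ t : ℝ × ℝ, 0 < t.1 → 0 < t.2 →
      ∫ z, ‖z‖ ^ 2 * |loopKernel i j k t z| ≤
        C * (t.1 ^ (-(3 / 4) : ℝ) * t.2 ^ (-(3 / 4) : ℝ)) := by
  obtain ⟨A, hA, hA'⟩ : ∃ A : ℝ, 0 ≤ A ∧ A = 1 + 2 ^ 3 * (Nat.factorial 3) :=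
    ⟨_, by positivity, rfl⟩
  obtain ⟨B, hB, hB'⟩ : ∃ B : ℝ, 0 ≤ B ∧ B = 1 + 2 ^ 5 * (Nat.factorial 5) :=
    ⟨_, by positivity, rfl⟩
  refine ⟨4 * Real.pi ^ 2 * (A * 128 + B * 512), by positivity, fun t h1 h2 => ?_⟩
  have hb : 0 < (t.1 + t.2) / (4 * t.1 * t.2) := by positivity
  obtain ⟨hq7, hq9⟩ := inv_sqrt_pow_div_le h1 h2
  have hle := norm_pow_mul_abs_loopKernel_le i j k 2 h1 h2
  have hint := integrable_norm_pow_mul_abs_loopKernel i j k 2 h1 h2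
  generalize (t.1 + t.2) / (4 * t.1 * t.2) = b at hb hq7 hq9 hle
  have hpt (z : E4) : ‖z‖ ^ 2 * |loopKernel i j k t z| ≤
      (1 / (t.1 ^ 3 * t.2 ^ 2) * (A * (√b)⁻¹ ^ 3) + 1 / (t.1 ^ 3 * t.2 ^ 3) * (B * (√b)⁻¹ ^ 5)) *
        Real.exp (-(b / 2) * ‖z‖ ^ 2) := by
    refine (hle z).trans ?_
    rw [add_mul, mul_assoc (1 / _), mul_assoc (1 / _), hA', hB']
    exact add_le_add
      (mul_le_mul_of_nonneg_left (norm_pow_mul_exp_neg_mul_sq_le 3 hb z) (by positivity))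
      (mul_le_mul_of_nonneg_left (norm_pow_mul_exp_neg_mul_sq_le 5 hb z) (by positivity))
  have hbs : (Real.pi / (b / 2)) ^ 2 = 4 * Real.pi ^ 2 * (√b)⁻¹ ^ 4 := by
    rw [inv_pow, show √b ^ 4 = (√b ^ 2) ^ 2 by ring, Real.sq_sqrt hb.le]
    field_simp
    norm_num
  calc ∫ z, ‖z‖ ^ 2 * |loopKernel i j k t z|
      ≤ ∫ z : E4, (1 / (t.1 ^ 3 * t.2 ^ 2) * (A * (√b)⁻¹ ^ 3) +
          1 / (t.1 ^ 3 * t.2 ^ 3) * (B * (√b)⁻¹ ^ 5)) * Real.exp (-(b / 2) * ‖z‖ ^ 2) :=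
        integral_mono hint ((integrable_exp_neg_mul_sq_norm (half_pos hb)).const_mul _) hpt
    _ = 4 * Real.pi ^ 2 * (A * ((√b)⁻¹ ^ 7 / (t.1 ^ 3 * t.2 ^ 2)) +
          B * ((√b)⁻¹ ^ 9 / (t.1 ^ 3 * t.2 ^ 3))) := by
        rw [integral_const_mul, integral_exp_neg_mul_sq_norm_four (half_pos hb), hbs]
        ring
    _ ≤ 4 * Real.pi ^ 2 * (A * (128 * (t.1 ^ (-(3 / 4) : ℝ) * t.2 ^ (-(3 / 4) : ℝ))) +
          B * (512 * (t.1 ^ (-(3 / 4) : ℝ) * t.2 ^ (-(3 / 4) : ℝ)))) := by gcongr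
    _ = _ := by ring

end LoopKernel

section MainTerm

theorem integral_integral_eq_of_hasDerivAt {f G Q : ℝ → ℝ → ℝ}
    (hG : ∀ a t, 0 < a → 0 < t → HasDerivAt (G a) (f a t) t)
    (hQ : ∀ a t, 0 < a → 0 < t → HasDerivAt (fun a => Q a t) (G a t) a)
    (hf : ∀ a, 0 < a → ContinuousOn (f a) (Set.Ioi 0))
    (hGc : ∀ t, 0 < t → ContinuousOn (fun a => G a t) (Set.Ioi 0))
    {ε L : ℝ} (hε : 0 < ε) (hL : 0 < L) :
    ∫ a in ε..L, ∫ t in ε..L, f a t = Q L L - Q ε L - (Q L ε - Q ε ε) := by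
  have hpos : Set.uIcc ε L ⊆ Set.Ioi 0 := fun a ha => (lt_min hε hL).trans_le ha.1
  have hinner : ∀ a ∈ Set.uIcc ε L, ∫ t in ε..L, f a t = G a L - G a ε := fun a ha =>
    intervalIntegral.integral_eq_sub_of_hasDerivAt (fun t ht => hG a t (hpos ha) (hpos ht))
      ((hf a (hpos ha)).mono hpos).intervalIntegrable
  rw [intervalIntegral.integral_congr hinner, intervalIntegral.integral_sub
      ((hGc L hL).mono hpos).intervalIntegrable ((hGc ε hε).mono hpos).intervalIntegrable,
    intervalIntegral.integral_eq_sub_of_hasDerivAt (fun a ha => hQ a L (hpos ha) hL)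
      ((hGc L hL).mono hpos).intervalIntegrable,
    intervalIntegral.integral_eq_sub_of_hasDerivAt (fun a ha => hQ a ε (hpos ha) hε)
      ((hGc ε hε).mono hpos).intervalIntegrable]

theorem exists_tendsto_integral_add_log (α β : ℝ) {L : ℝ} (hL : 0 < L) :
    ∃ c : ℝ, Tendsto (fun ε : ℝ =>
      (∫ a in ε..L, ∫ t in ε..L, (α * (t / (a + t) ^ 3) + β * (a * t / (a + t) ^ 4))) +
        (α / 2 + β / 6) * Real.log ε) (𝓝[>] 0) (𝓝 c) := by
  set Q : ℝ → ℝ → ℝ := fun a t =>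
    α * (-(1 / 2) * Real.log (a + t) + 1 / 2 * (t / (a + t))) +
      β * (-(1 / 6) * Real.log (a + t) + 1 / 6 * (t / (a + t)) - 1 / 6 * (t ^ 2 / (a + t) ^ 2))
    with hQdef
  set G : ℝ → ℝ → ℝ := fun a t =>
    α * (-(1 / (a + t)) + 1 / 2 * (a / (a + t) ^ 2)) +
      β * (-(1 / 2) * (a / (a + t) ^ 2) + 1 / 3 * (a ^ 2 / (a + t) ^ 3)) with hGdef
  have hint : ∀ ε, 0 < ε →
      ∫ a in ε..L, ∫ t in ε..L, (α * (t / (a + t) ^ 3) + β * (a * t / (a + t) ^ 4)) =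
        Q L L - Q ε L - (Q L ε - Q ε ε) := by
    intro ε hε
    refine integral_integral_eq_of_hasDerivAt (G := G) ?_ ?_ ?_ ?_ hε hL
    · intro a t ha ht
      have hs : HasDerivAt (fun t => a + t) 1 t := (hasDerivAt_id t).const_add a
      have hne : a + t ≠ 0 := by positivity
      have h := (((((hasDerivAt_const t (1 : ℝ)).div hs hne).neg).add
        (((hasDerivAt_const t a).div (hs.pow 2) (pow_ne_zero 2 hne)).const_mul
          (1 / 2))).const_mul α).add
        (((((hasDerivAt_const t a).div (hs.pow 2) (pow_ne_zero 2 hne)).const_mul (-(1 / 2))).add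
        (((hasDerivAt_const t (a ^ 2)).div (hs.pow 3) (pow_ne_zero 3 hne)).const_mul
          (1 / 3))).const_mul β)
      refine h.congr_deriv ?_
      simp only [Pi.pow_apply]
      field_simp
      ring
    · intro a t ha ht
      have hs : HasDerivAt (fun a => a + t) 1 a := (hasDerivAt_id a).add_const t
      have hne : a + t ≠ 0 := by positivity
      have hd := ((hasDerivAt_const a t).div hs hne)
      have hlog := hs.log hne
      have h := (((hlog.const_mul (-(1 / 2))).add (hd.const_mul (1 / 2))).const_mul α).add
        ((((hlog.const_mul (-(1 / 6))).add (hd.const_mul (1 / 6))).sub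
        (((hasDerivAt_const a (t ^ 2)).div (hs.pow 2) (pow_ne_zero 2 hne)).const_mul
          (1 / 6))).const_mul β)
      refine h.congr_deriv ?_
      simp only [Pi.pow_apply, hGdef]
      field_simp
      ring
    · intro a ha t ht
      have ht' : 0 < t := ht
      have hne : a + t ≠ 0 := by positivity
      exact ContinuousAt.continuousWithinAt (by fun_prop (disch := positivity))
    · intro t ht a ha
      have ha' : 0 < a := ha
      have hne : a + t ≠ 0 := by positivity
      exact ContinuousAt.continuousWithinAt (by simp only [hGdef]; fun_prop (disch := positivity))
  have hcont1 : ContinuousAt (fun ε => Q ε L) 0 := by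
    have hne : 0 + L ≠ 0 := by positivity
    simp only [hQdef]
    fun_prop (disch := positivity)
  have hcont2 : ContinuousAt (fun ε => Q L ε) 0 := by
    have hne : L + 0 ≠ 0 := by positivity
    simp only [hQdef]
    fun_prop (disch := positivity)
  have hdiag : ∀ ε, 0 < ε → Q ε ε + (α / 2 + β / 6) * Real.log ε =
      α * (-(1 / 2) * Real.log 2 + 1 / 4) + β * (-(1 / 6) * Real.log 2 + 1 / 24) := by
    intro ε hε
    simp only [hQdef]
    rw [← two_mul, Real.log_mul two_ne_zero hε.ne']
    field_simp
    ring
  refine ⟨Q L L - Q 0 L - Q L 0 + (α * (-(1 / 2) * Real.log 2 + 1 / 4) +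
    β * (-(1 / 6) * Real.log 2 + 1 / 24)), ?_⟩
  have hlim := (((tendsto_const_nhds (x := Q L L)).sub hcont1.tendsto).sub hcont2.tendsto).add_const
    (α * (-(1 / 2) * Real.log 2 + 1 / 4) + β * (-(1 / 6) * Real.log 2 + 1 / 24))
  refine (hlim.mono_left nhdsWithin_le_nhds).congr' ?_
  filter_upwards [self_mem_nhdsWithin] with ε hε
  rw [hint ε hε, ← hdiag ε hε]
  ring

end MainTerm

section Remainder

local notation "E4" => EuclideanSpace ℝ (Fin 4)

theorem exists_abs_sub_sub_fderiv_le {V : Type*} [NormedAddCommGroup V] [NormedSpace ℝ V]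
    {f : V → ℝ} (hf : ContDiff ℝ 2 f) (hfc : HasCompactSupport f) :
    ∃ C : ℝ, 0 ≤ C ∧ ∀ x v, |f (x + v) - f x - fderiv ℝ f x v| ≤ C * ‖v‖ ^ 2 := by
  obtain ⟨K, hK⟩ := (hf.fderiv_right (m := 1) (by norm_num)).lipschitzWith_of_hasCompactSupport
    (hfc.fderiv ℝ) one_ne_zero
  refine ⟨K, K.2, fun x v => ?_⟩
  have h := (convex_closedBall x ‖v‖).norm_image_sub_le_of_norm_fderiv_le' (𝕜 := ℝ) (f := f)
    (φ := fderiv ℝ f x) (C := K * ‖v‖) (x := x) (y := x + v)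
    (fun y _ => hf.differentiable (by norm_num) y)
    (fun y hy => (hK.norm_sub_le y x).trans (by
      gcongr
      simpa [dist_eq_norm] using hy))
    (Metric.mem_closedBall_self (norm_nonneg _)) (by simp [dist_eq_norm])
  rw [add_sub_cancel_left, Real.norm_eq_abs] at h
  linarith

variable (i j k : Fin 4) {φ : E4 × E4 → ℝ}

theorem integrable_mul_loopKernel_sub (hφ : Continuous φ) (hφc : HasCompactSupport φ) (t : ℝ × ℝ) :
    Integrable fun p : E4 × E4 => φ p * loopKernel i j k t (p.1 - p.2) := by
  have hc := continuous_loopKernel i j k t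
  exact Continuous.integrable_of_hasCompactSupport (by fun_prop) hφc.mul_right

theorem integrable_fderiv_diag (hφ : ContDiff ℝ 2 φ) (hφc : HasCompactSupport φ) (v : E4 × E4) :
    Integrable fun y : E4 => fderiv ℝ φ (y, y) v := by
  have hc : Continuous (fderiv ℝ φ) := hφ.continuous_fderiv (by norm_num)
  refine Continuous.integrable_of_hasCompactSupport (by fun_prop) ?_
  have hdiag : IsClosedEmbedding fun y : E4 => (y, y) :=
    .of_continuous_injective_isClosedMap (by fun_prop) (fun a b h => congrArg Prod.fst h)
      (fun s hs => by
        have : (fun y : E4 => (y, y)) '' s = {p | p.1 = p.2 ∧ p.1 ∈ s} := by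
          ext ⟨a, b⟩
          simp only [Set.mem_image, Prod.mk.injEq, Set.mem_ofPred_eq]
          exact ⟨fun ⟨x, hx, h1, h2⟩ => ⟨h1.symm.trans h2, h1 ▸ hx⟩,
            fun ⟨h, ha⟩ => ⟨a, ha, rfl, h⟩⟩
        rw [this]
        exact (isClosed_eq continuous_fst continuous_snd).inter (hs.preimage continuous_fst))
  exact ((hφc.fderiv ℝ).comp_isClosedEmbedding hdiag).comp_left
    (g := fun l : E4 × E4 →L[ℝ] ℝ => l v) rfl

theorem apply_eq_sum_coord (l : E4 × E4 →L[ℝ] ℝ) (z : E4) :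
    l (z, 0) = ∑ m, l (EuclideanSpace.single m 1, 0) * z m := by
  have hz : l (z, 0) = (l.comp (ContinuousLinearMap.inl ℝ E4 E4)) z := by simp
  conv_lhs => rw [hz, ← (EuclideanSpace.basisFun (Fin 4) ℝ).sum_repr z]
  simp [mul_comm]

/-- Up to an absolutely integrable error in `t`, pairing `φ` with `loopKernel` only sees the
first order Taylor expansion of `φ` at the diagonal. -/
theorem exists_abs_integral_loopKernel_sub_le (hφ : ContDiff ℝ 2 φ) (hφc : HasCompactSupport φ) :
    ∃ C : ℝ, ∀ t : ℝ × ℝ, 0 < t.1 → 0 < t.2 →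
      |(∫ p : E4 × E4, φ p * loopKernel i j k t (p.1 - p.2)) -
        ∑ l, (∫ y : E4, fderiv ℝ φ (y, y) (EuclideanSpace.single l 1, 0)) *
          loopMoment i j k l t| ≤ C * (t.1 ^ (-(3 / 4) : ℝ) * t.2 ^ (-(3 / 4) : ℝ)) := by
  obtain ⟨C, hC, hTaylor⟩ := exists_abs_sub_sub_fderiv_le hφ hφc
  obtain ⟨M, hM, hMle⟩ := exists_integral_sq_norm_mul_abs_loopKernel_le i j k
  have hB : IsCompact (Prod.snd '' tsupport φ) := hφc.isCompact.image continuous_snd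
  refine ⟨volume.real (Prod.snd '' tsupport φ) * (C * M), fun t h1 h2 => ?_⟩
  have hφ0 : Continuous φ := hφ.continuous
  have hK := continuous_loopKernel i j k t
  set T := t.1 ^ (-(3 / 4) : ℝ) * t.2 ^ (-(3 / 4) : ℝ)
  set r : E4 → E4 → ℝ := fun y z => φ (z + y, y) - φ (y, y) - fderiv ℝ φ (y, y) (z, 0) with hr
  have hrle (y z : E4) : |r y z| ≤ C * ‖z‖ ^ 2 := by
    simpa [hr, add_comm] using hTaylor (y, y) (z, 0)
  have hrint (y : E4) : Integrable fun z => r y z * loopKernel i j k t z :=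
    integrable_mul_loopKernel i j k (by simp only [hr]; fun_prop) 2 (hrle y) h1 h2
  have hcoord (l : Fin 4) : Integrable fun z : E4 => z l * loopKernel i j k t z :=
    integrable_mul_loopKernel i j k (by fun_prop) 1 (C := 1)
      (fun z => by simpa using abs_euclideanSpace_apply_le z l) h1 h2
  have hconst (c : ℝ) : Integrable fun z : E4 => c * loopKernel i j k t z :=
    integrable_mul_loopKernel i j k (by fun_prop) 0 (C := |c|) (fun z => by simp) h1 h2
  have hinner (y : E4) : ∫ z, φ (z + y, y) * loopKernel i j k t z =
      (∫ z, r y z * loopKernel i j k t z) +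
        ∑ l, fderiv ℝ φ (y, y) (EuclideanSpace.single l 1, 0) * loopMoment i j k l t := by
    have hexp (z : E4) : φ (z + y, y) * loopKernel i j k t z =
        (r y z * loopKernel i j k t z + φ (y, y) * loopKernel i j k t z) +
        ∑ l, fderiv ℝ φ (y, y) (EuclideanSpace.single l 1, 0) * (z l * loopKernel i j k t z) := by
      simp only [hr, apply_eq_sum_coord _ z, ← mul_assoc, ← Finset.sum_mul]
      ring
    simp only [hexp]
    rw [integral_add ((hrint y).fun_add (hconst _))
        (integrable_finsetSum _ fun l _ => (hcoord l).const_mul _),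
      integral_add (hrint y) (hconst _), integral_finsetSum _ fun l _ => (hcoord l).const_mul _]
    simp only [integral_const_mul, integral_loopKernel, mul_zero, add_zero,
      integral_coord_mul_loopKernel i j k _ h1 h2]
  have hF := integrable_mul_loopKernel_sub i j k hφ0 hφc t
  have hshift (y : E4) : ∫ x, φ (x, y) * loopKernel i j k t (x - y) =
      ∫ z, φ (z + y, y) * loopKernel i j k t z := by
    rw [← integral_add_right_eq_self _ y]
    simp
  have hlin : Integrable fun y : E4 =>
      ∑ l, fderiv ℝ φ (y, y) (EuclideanSpace.single l 1, 0) * loopMoment i j k l t :=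
    integrable_finsetSum _ fun l _ => (integrable_fderiv_diag hφ hφc _).mul_const _
  have hΦ : Integrable fun y : E4 => ∫ x, φ (x, y) * loopKernel i j k t (x - y) :=
    Integrable.integral_prod_right hF
  have hdiff : (∫ p : E4 × E4, φ p * loopKernel i j k t (p.1 - p.2)) -
      ∑ l, (∫ y : E4, fderiv ℝ φ (y, y) (EuclideanSpace.single l 1, 0)) * loopMoment i j k l t =
      ∫ y, ∫ z, r y z * loopKernel i j k t z := by
    simp only [← integral_mul_const]
    rw [← integral_finsetSum _ fun l _ => (integrable_fderiv_diag hφ hφc _).mul_const _,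
      Measure.volume_eq_prod, integral_prod_symm _ hF, ← integral_sub hΦ hlin]
    simp only [hshift, hinner, add_sub_cancel_right]
  have hr0 (y : E4) (hy : y ∉ Prod.snd '' tsupport φ) (z : E4) : r y z = 0 := by
    have hmem (x : E4) : (x, y) ∉ tsupport φ := fun h => hy ⟨_, h, rfl⟩
    have hzero (x : E4) : φ (x, y) = 0 := image_eq_zero_of_notMem_tsupport (hmem x)
    have hfd : fderiv ℝ φ (y, y) = 0 := fderiv_of_notMem_tsupport ℝ (hmem y)
    simp [hr, hzero, hfd]
  have hbound (y : E4) : ‖∫ z, r y z * loopKernel i j k t z‖ ≤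
      (Prod.snd '' tsupport φ).indicator (fun _ => C * (M * T)) y := by
    by_cases hy : y ∈ Prod.snd '' tsupport φ
    · rw [Set.indicator_of_mem hy]
      calc ‖∫ z, r y z * loopKernel i j k t z‖
          ≤ ∫ z, C * (‖z‖ ^ 2 * |loopKernel i j k t z|) := by
            refine norm_integral_le_of_norm_le
              ((integrable_norm_pow_mul_abs_loopKernel i j k 2 h1 h2).const_mul C)
              (.of_forall fun z => ?_)
            rw [norm_mul, Real.norm_eq_abs, Real.norm_eq_abs, ← mul_assoc]
            gcongr
            exact hrle y z
        _ ≤ C * (M * T) := by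
            rw [integral_const_mul]
            gcongr
            exact hMle t h1 h2
    · rw [Set.indicator_of_notMem hy]
      simp [hr0 y hy]
  rw [hdiff, ← Real.norm_eq_abs]
  refine (norm_integral_le_of_norm_le ?_ (.of_forall hbound)).trans_eq ?_
  · exact (integrable_indicator_iff hB.measurableSet).2 (integrableOn_const hB.measure_lt_top.ne)
  · rw [integral_indicator_const _ hB.measurableSet, smul_eq_mul]
    ring

end Remainder

section Assembly

local notation "E4" => EuclideanSpace ℝ (Fin 4)

variable (i j k : Fin 4) {φ : E4 × E4 → ℝ}

theorem continuousOn_mul_loopKernel_sub (hφ : Continuous φ) :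
    ContinuousOn (fun q : (E4 × E4) × ℝ × ℝ => φ q.1 * loopKernel i j k q.2 (q.1.1 - q.1.2))
      {q | 0 < q.2.1 ∧ 0 < q.2.2} := by
  refine (hφ.comp continuous_fst).continuousOn.mul ?_
  exact (continuousOn_loopKernel i j k).comp
    (f := fun q : (E4 × E4) × ℝ × ℝ => (q.2, q.1.1 - q.1.2)) (by fun_prop) (fun q hq => hq)

theorem integrable_mul_loopKernel_prod (hφ : Continuous φ) (hφc : HasCompactSupport φ)
    {ε : ℝ} (hε : 0 < ε) (L : ℝ) :
    Integrable (fun q : (E4 × E4) × ℝ × ℝ => φ q.1 * loopKernel i j k q.2 (q.1.1 - q.1.2))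
      ((volume : Measure (E4 × E4)).prod
        ((volume : Measure (ℝ × ℝ)).restrict (Set.Ioc ε L ×ˢ Set.Ioc ε L))) := by
  have hpos : ∀ q : (E4 × E4) × ℝ × ℝ, q.2 ∈ Set.Icc ε L ×ˢ Set.Icc ε L →
      0 < q.2.1 ∧ 0 < q.2.2 := fun q hq => ⟨hε.trans_le hq.1.1, hε.trans_le hq.2.1⟩
  have hcompact : IntegrableOn
      (fun q : (E4 × E4) × ℝ × ℝ => φ q.1 * loopKernel i j k q.2 (q.1.1 - q.1.2))
      (tsupport φ ×ˢ (Set.Icc ε L ×ˢ Set.Icc ε L)) (volume.prod volume) :=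
    ((continuousOn_mul_loopKernel_sub i j k hφ).mono
      fun q hq => hpos q hq.2).integrableOn_compact
      (hφc.isCompact.prod (isCompact_Icc.prod isCompact_Icc))
  have hall : IntegrableOn
      (fun q : (E4 × E4) × ℝ × ℝ => φ q.1 * loopKernel i j k q.2 (q.1.1 - q.1.2))
      (Set.univ ×ˢ (Set.Icc ε L ×ˢ Set.Icc ε L)) (volume.prod volume) := by
    refine hcompact.of_forall_sdiff_eq_zero
      (MeasurableSet.univ.prod (measurableSet_Icc.prod measurableSet_Icc)) fun q hq => ?_
    have : q.1 ∉ tsupport φ := fun h => hq.2 ⟨h, hq.1.2⟩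
    simp [image_eq_zero_of_notMem_tsupport this]
  have h := hall.mono_set (Set.prod_mono_right (Set.prod_mono Set.Ioc_subset_Icc_self
    Set.Ioc_subset_Icc_self) : Set.univ ×ˢ (Set.Ioc ε L ×ˢ Set.Ioc ε L) ⊆ _)
  rwa [IntegrableOn, ← Measure.prod_restrict, Measure.restrict_univ] at h

theorem setIntegral_Ioc_prod_eq {f : ℝ × ℝ → ℝ} (hf : ContinuousOn f {t | 0 < t.1 ∧ 0 < t.2})
    {ε L : ℝ} (hε : 0 < ε) (hεL : ε ≤ L) :
    IntegrableOn f (Set.Ioc ε L ×ˢ Set.Ioc ε L) ∧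
      ∫ t in Set.Ioc ε L ×ˢ Set.Ioc ε L, f t = ∫ a in ε..L, ∫ b in ε..L, f (a, b) := by
  have hint : IntegrableOn f (Set.Ioc ε L ×ˢ Set.Ioc ε L) :=
    ((hf.mono fun t (ht : t ∈ Set.Icc ε L ×ˢ Set.Icc ε L) =>
      ⟨hε.trans_le ht.1.1, hε.trans_le ht.2.1⟩).integrableOn_compact
      (isCompact_Icc.prod isCompact_Icc)).mono_set
        (Set.prod_mono Set.Ioc_subset_Icc_self Set.Ioc_subset_Icc_self)
  refine ⟨hint, ?_⟩
  rw [Measure.volume_eq_prod, setIntegral_prod _ hint]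
  simp only [intervalIntegral.integral_of_le hεL]

theorem integral_interval_loopKernel_eq (hφ : Continuous φ) (hφc : HasCompactSupport φ)
    {ε L : ℝ} (hε : 0 < ε) (hεL : ε ≤ L) :
    IntegrableOn (fun t : ℝ × ℝ => ∫ p : E4 × E4, φ p * loopKernel i j k t (p.1 - p.2))
      (Set.Ioc ε L ×ˢ Set.Ioc ε L) ∧
    ∫ p : E4 × E4, ∫ t₁ in ε..L, ∫ t₂ in ε..L, φ p * loopKernel i j k (t₁, t₂) (p.1 - p.2) =
      ∫ t in Set.Ioc ε L ×ˢ Set.Ioc ε L,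
        ∫ p : E4 × E4, φ p * loopKernel i j k t (p.1 - p.2) := by
  have hint := integrable_mul_loopKernel_prod i j k hφ hφc hε L
  refine ⟨hint.integral_prod_right, ?_⟩
  rw [← integral_integral_swap hint]
  congr 1 with p
  refine (setIntegral_Ioc_prod_eq (f := fun t => φ p * loopKernel i j k t (p.1 - p.2))
    ?_ hε hεL).2.symm
  exact (continuousOn_mul_loopKernel_sub i j k hφ).comp
    (f := fun t : ℝ × ℝ => (p, t)) (by fun_prop) (fun t ht => ht)

theorem stronglyMeasurable_integral_loopKernel (hφ : Continuous φ) :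
    StronglyMeasurable fun t : ℝ × ℝ => ∫ p : E4 × E4, φ p * loopKernel i j k t (p.1 - p.2) := by
  have hm : Measurable fun q : (ℝ × ℝ) × (E4 × E4) =>
      φ q.2 * loopKernel i j k q.1 (q.2.1 - q.2.2) := by
    refine (hφ.measurable.comp measurable_snd).mul ?_
    exact (measurable_loopKernel i j k).comp
      (f := fun q : (ℝ × ℝ) × (E4 × E4) => (q.1, q.2.1 - q.2.2)) (by fun_prop)
  exact hm.stronglyMeasurable.integral_prod_right

theorem integrableOn_Ioc_rpow_mul_rpow {r : ℝ} (hr : -1 < r) {L : ℝ} (hL : 0 ≤ L) :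
    IntegrableOn (fun t : ℝ × ℝ => t.1 ^ r * t.2 ^ r) (Set.Ioc 0 L ×ˢ Set.Ioc 0 L) := by
  have h : IntegrableOn (fun x : ℝ => x ^ r) (Set.Ioc 0 L) :=
    (intervalIntegrable_iff_integrableOn_Ioc_of_le hL).1
      (intervalIntegral.intervalIntegrable_rpow' hr)
  rw [IntegrableOn, Measure.volume_eq_prod, ← Measure.prod_restrict]
  exact Integrable.mul_prod h h

theorem tendsto_setIntegral_Ioc_prod {f : ℝ × ℝ → ℝ} {L : ℝ}
    (hf : IntegrableOn f (Set.Ioc 0 L ×ˢ Set.Ioc 0 L)) :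
    Tendsto (fun ε => ∫ t in Set.Ioc ε L ×ˢ Set.Ioc ε L, f t) (𝓝[>] 0)
      (𝓝 (∫ t in Set.Ioc 0 L ×ˢ Set.Ioc 0 L, f t)) := by
  have hmeas (ε : ℝ) : MeasurableSet (Set.Ioc ε L ×ˢ Set.Ioc ε L) :=
    measurableSet_Ioc.prod measurableSet_Ioc
  have hsub {ε : ℝ} (hε : 0 < ε) :
      Set.Ioc ε L ×ˢ Set.Ioc ε L ⊆ Set.Ioc 0 L ×ˢ Set.Ioc 0 L :=
    Set.prod_mono (Set.Ioc_subset_Ioc_left hε.le) (Set.Ioc_subset_Ioc_left hε.le)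
  have hlim : Tendsto (fun ε => ∫ t in Set.Ioc 0 L ×ˢ Set.Ioc 0 L,
      (Set.Ioc ε L ×ˢ Set.Ioc ε L).indicator f t) (𝓝[>] 0)
      (𝓝 (∫ t in Set.Ioc 0 L ×ˢ Set.Ioc 0 L, f t)) := by
    refine tendsto_integral_filter_of_dominated_convergence (fun t => ‖f t‖)
      (.of_forall fun ε => hf.1.indicator (hmeas ε))
      (.of_forall fun ε => .of_forall fun t => norm_indicator_le_norm_self _ _) hf.norm ?_
    filter_upwards [ae_restrict_mem (hmeas 0)] with t ht
    refine tendsto_const_nhds.congr' ?_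
    filter_upwards [Ioo_mem_nhdsGT (lt_min ht.1.1 ht.2.1)] with ε hε
    exact (Set.indicator_of_mem (s := Set.Ioc ε L ×ˢ Set.Ioc ε L)
      ⟨⟨hε.2.trans_le (min_le_left _ _), ht.1.2⟩,
        ⟨hε.2.trans_le (min_le_right _ _), ht.2.2⟩⟩ f).symm
  refine hlim.congr' ?_
  filter_upwards [self_mem_nhdsWithin] with ε hε
  rw [setIntegral_indicator (hmeas ε), Set.inter_eq_right.2 (hsub hε)]

theorem sum_mul_loopMoment (D : Fin 4 → ℝ) (t : ℝ × ℝ) :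
    ∑ l, D l * loopMoment i j k l t =
      1 / (32 * Real.pi ^ 2) * ((if j = k then 1 else 0) * D i) * (t.2 / (t.1 + t.2) ^ 3) +
      -(1 / (32 * Real.pi ^ 2)) * ((if i = j then 1 else 0) * D k +
        (if i = k then 1 else 0) * D j + (if j = k then 1 else 0) * D i) *
        (t.1 * t.2 / (t.1 + t.2) ^ 4) := by
  have hterm (l : Fin 4) : D l * loopMoment i j k l t =
      1 / (32 * Real.pi ^ 2) * (if j = k then 1 else 0) * (t.2 / (t.1 + t.2) ^ 3) *
        (if i = l then D l else 0) -
      1 / (32 * Real.pi ^ 2) * (t.1 * t.2 / (t.1 + t.2) ^ 4) *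
        ((if i = j then 1 else 0) * (if k = l then D l else 0) +
          (if i = k then 1 else 0) * (if j = l then D l else 0) +
          (if j = k then 1 else 0) * (if i = l then D l else 0)) := by
    simp only [loopMoment, ← mul_boole _ (D l)]
    ring
  simp only [hterm, Finset.sum_sub_distrib, ← Finset.mul_sum, Finset.sum_add_distrib,
    Finset.sum_ite_eq, Finset.mem_univ, if_true]
  ring

end Assembly

/-- The regularized one-loop weight with one `∂_x`-propagator and one `t₂·∂_x∂_x`-propagator
has logarithmic singular part
`(1/(192π²)) (δ_{ij} ∫ ∂_kφ + δ_{ik} ∫ ∂_jφ − 2δ_{jk} ∫ ∂_iφ) · log ε` as `ε → 0⁺`. -/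
theorem log_divergence_xxx
    (L : ℝ) (hL : 0 < L) (i j k : Fin 4)
    (φ : EuclideanSpace ℝ (Fin 4) × EuclideanSpace ℝ (Fin 4) → ℝ)
    (hφ : ContDiff ℝ (⊤ : ℕ∞) φ) (hφc : HasCompactSupport φ) :
    ∃ c : ℝ, Filter.Tendsto
      (fun ε : ℝ =>
        (∫ p : EuclideanSpace ℝ (Fin 4) × EuclideanSpace ℝ (Fin 4),
          ∫ t₁ in ε..L, ∫ t₂ in ε..L,
            φ p * t₂ * heatKernelDx i t₁ p.1 p.2 * heatKernelDxx j k t₂ p.1 p.2) -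
        ((1 / (192 * Real.pi ^ 2)) *
          ((if i = j then (1 : ℝ) else 0) *
              (∫ x : EuclideanSpace ℝ (Fin 4),
                fderiv ℝ φ (x, x) (EuclideanSpace.single k 1, 0)) +
           (if i = k then (1 : ℝ) else 0) *
              (∫ x : EuclideanSpace ℝ (Fin 4),
                fderiv ℝ φ (x, x) (EuclideanSpace.single j 1, 0)) -
           2 * (if j = k then (1 : ℝ) else 0) *
              (∫ x : EuclideanSpace ℝ (Fin 4),
                fderiv ℝ φ (x, x) (EuclideanSpace.single i 1, 0)))) * Real.log ε)
      (𝓝[>] 0) (𝓝 c) := by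
  have hφ2 : ContDiff ℝ 2 φ := contDiff_infty.1 hφ 2
  set D : Fin 4 → ℝ := fun l =>
    ∫ x : EuclideanSpace ℝ (Fin 4), fderiv ℝ φ (x, x) (EuclideanSpace.single l 1, 0)
  set g : ℝ × ℝ → ℝ := fun t =>
    ∫ p : EuclideanSpace ℝ (Fin 4) × EuclideanSpace ℝ (Fin 4),
      φ p * loopKernel i j k t (p.1 - p.2)
  set α := 1 / (32 * Real.pi ^ 2) * ((if j = k then 1 else 0) * D i) with hα
  set β := -(1 / (32 * Real.pi ^ 2)) * ((if i = j then 1 else 0) * D k +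
    (if i = k then 1 else 0) * D j + (if j = k then 1 else 0) * D i) with hβ
  set m : ℝ × ℝ → ℝ := fun t =>
    α * (t.2 / (t.1 + t.2) ^ 3) + β * (t.1 * t.2 / (t.1 + t.2) ^ 4) with hm
  have hmcont : ContinuousOn m {t | 0 < t.1 ∧ 0 < t.2} := by
    rintro t ⟨h1, h2⟩
    have hne : t.1 + t.2 ≠ 0 := by positivity
    exact ContinuousAt.continuousWithinAt (by simp only [hm]; fun_prop (disch := positivity))
  obtain ⟨C, hC⟩ := exists_abs_integral_loopKernel_sub_le i j k hφ2 hφc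
  have hR : IntegrableOn (fun t => g t - m t) (Set.Ioc 0 L ×ˢ Set.Ioc 0 L) := by
    refine ((integrableOn_Ioc_rpow_mul_rpow (r := -(3 / 4)) (by norm_num) hL.le).const_mul C).mono'
      ((stronglyMeasurable_integral_loopKernel i j k hφ.continuous).aestronglyMeasurable.sub
        (Measurable.aestronglyMeasurable (by fun_prop))) ?_
    filter_upwards [ae_restrict_mem (measurableSet_Ioc.prod measurableSet_Ioc)] with t ht
    have h := hC t ht.1.1 ht.2.1
    rwa [sum_mul_loopMoment i j k D t] at h
  obtain ⟨c, hc⟩ := exists_tendsto_integral_add_log α β hL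
  refine ⟨c + ∫ t in Set.Ioc 0 L ×ˢ Set.Ioc 0 L, (g t - m t),
    (hc.add (tendsto_setIntegral_Ioc_prod hR)).congr' ?_⟩
  filter_upwards [Ioo_mem_nhdsGT hL] with ε hε
  obtain ⟨hgint, hg⟩ := integral_interval_loopKernel_eq i j k hφ.continuous hφc hε.1 hε.2.le
  obtain ⟨hmint, hmeq⟩ := setIntegral_Ioc_prod_eq hmcont hε.1 hε.2.le
  simp only [mul_assoc (φ _)]
  simp only [loopKernel_sub] at hg
  rw [hg, integral_sub hgint hmint, hmeq]
  have hcoef : α / 2 + β / 6 = -(1 / (192 * Real.pi ^ 2) *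
      ((if i = j then 1 else 0) * D k + (if i = k then 1 else 0) * D j -
        2 * (if j = k then 1 else 0) * D i)) := by
    rw [hα, hβ]
    ring
  rw [hcoef]
  simp only [← loopKernel_sub]
  ring
end

section
/- For t > 0 and x, y ∈ ℝ⁴, let k_t(x,y) = (4πt)^{−2} exp(−‖x−y‖²/(4t)) be the scalar heat kernel on ℝ⁴. Fix L > 0 and a smooth compactly supported function φ : ℝ⁴ × ℝ⁴ → ℝ. For 0 < ε < L define I(ε) = ∫_{ℝ⁴×ℝ⁴} ∫_{[ε,L]²} φ(x,y) · t₁ t₂ · (∂k_{t₁}/∂t₁)(x,y) (∂k_{t₂}/∂t₂)(x,y) dt₁ dt₂ dx dy. Then I(ε) + (1/(16π²)) ( ∫_{ℝ⁴} φ(x,x) dx ) · log ε converges to a finite limit as ε → 0⁺; that is, the logarithmic singular part of I(ε) equals −(1/(16π²)) ∫_{ℝ⁴} φ(x,x) dx times log ε. -/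
open MeasureTheory Filter Topology

/-- The time derivative `∂k_t/∂t` of the scalar heat kernel
`k_t(x,y) = (4πt)⁻² exp(-‖x-y‖²/(4t))` on `ℝ⁴`. -/
noncomputable def heatKernelDt (t : ℝ)
    (x y : EuclideanSpace ℝ (Fin 4)) : ℝ :=
  (1 / (4 * Real.pi) ^ 2) * (-2 / t ^ 3 + ‖x - y‖ ^ 2 / (4 * t ^ 4)) *
    Real.exp (-‖x - y‖ ^ 2 / (4 * t))

/-- The profile `s ↦ (1 - s) e⁻ˢ` of the primitive of `t ↦ t ∂k_t/∂t` in terms of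
`s = ‖x - y‖² / (4t)`. -/
noncomputable def expProfile (s : ℝ) : ℝ := (1 - s) * Real.exp (-s)

/-- The closed form of `∫ t in ε..L, t ∂k_t/∂t` as a function of the distance `r = ‖x - y‖`. -/
noncomputable def regPropagator (ε L r : ℝ) : ℝ :=
  1 / (4 * Real.pi ^ 2 * r ^ 2) * (expProfile (r ^ 2 / (4 * ε)) - expProfile (r ^ 2 / (4 * L)))

lemma continuous_expProfile : Continuous expProfile := by
  unfold expProfile; fun_prop

lemma measurable_regPropagator (ε L : ℝ) : Measurable (regPropagator ε L) := by
  have := continuous_expProfile.measurable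
  unfold regPropagator; fun_prop

lemma hasDerivAt_expProfile (s : ℝ) : HasDerivAt expProfile ((s - 2) * Real.exp (-s)) s := by
  have h := ((hasDerivAt_id s).const_sub 1).mul (hasDerivAt_id s).neg.exp
  refine h.congr_deriv ?_
  simp only [id, Pi.neg_apply]
  ring

lemma two_add_mul_exp_neg_le {s : ℝ} : (2 + s) * Real.exp (-s) ≤ 2 * Real.exp (-s / 2) := by
  have h1 : s / 2 + 1 ≤ Real.exp (s / 2) := Real.add_one_le_exp _
  have h2 : Real.exp (-s / 2) = Real.exp (s / 2) * Real.exp (-s) := by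
    rw [← Real.exp_add]; ring_nf
  rw [h2]
  nlinarith [Real.exp_pos (-s)]

lemma abs_expProfile_le {s : ℝ} (hs : 0 ≤ s) : |expProfile s| ≤ 2 * Real.exp (-s / 2) := by
  refine le_trans ?_ two_add_mul_exp_neg_le
  rw [expProfile, abs_mul, abs_of_pos (Real.exp_pos _)]
  gcongr
  rw [abs_le]
  constructor <;> linarith

lemma abs_expProfile_sub_le {u v : ℝ} (hu : 0 ≤ u) (huv : u ≤ v) :
    |expProfile v - expProfile u| ≤ 2 * Real.exp (-u / 2) * (v - u) := by
  have h := (convex_Icc u v).norm_image_sub_le_of_norm_hasDerivWithin_le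
    (f := expProfile) (C := 2 * Real.exp (-u / 2))
    (fun s _ => (hasDerivAt_expProfile s).hasDerivWithinAt) (fun s hs => ?_)
    (Set.left_mem_Icc.2 huv) (Set.right_mem_Icc.2 huv)
  · rwa [Real.norm_eq_abs, Real.norm_eq_abs, abs_of_nonneg (sub_nonneg.2 huv)] at h
  · have hs0 : 0 ≤ s := hu.trans hs.1
    rw [Real.norm_eq_abs, abs_mul, abs_of_pos (Real.exp_pos _)]
    calc |s - 2| * Real.exp (-s) ≤ (2 + s) * Real.exp (-s) := by
          gcongr
          rw [abs_le]
          constructor <;> linarith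
      _ ≤ 2 * Real.exp (-s / 2) := two_add_mul_exp_neg_le
      _ ≤ 2 * Real.exp (-u / 2) := by
          have := hs.1
          gcongr

lemma tendsto_expProfile_atTop : Tendsto expProfile atTop (𝓝 0) := by
  have h : Tendsto (fun s : ℝ => 2 * Real.exp (-s / 2)) atTop (𝓝 0) := by
    have : Tendsto (fun s : ℝ => -s / 2) atTop atBot :=
      tendsto_neg_atTop_atBot.atBot_div_const two_pos
    simpa using (Real.tendsto_exp_atBot.comp this).const_mul 2
  refine squeeze_zero_norm' ?_ h
  filter_upwards [eventually_ge_atTop 0] with s hs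
  exact abs_expProfile_le hs

lemma integral_mul_heatKernelDt {ε L : ℝ} (hε : 0 < ε) (hεL : ε ≤ L)
    {x y : EuclideanSpace ℝ (Fin 4)} (hxy : ‖x - y‖ ≠ 0) :
    ∫ t in ε..L, t * heatKernelDt t x y = regPropagator ε L ‖x - y‖ := by
  set r := ‖x - y‖ with hr
  have hpos : ∀ t ∈ Set.uIcc ε L, 0 < t := fun t ht => by
    rw [Set.uIcc_of_le hεL] at ht
    exact hε.trans_le ht.1
  rw [intervalIntegral.integral_eq_sub_of_hasDerivAt
    (f := fun t => -(1 / (4 * Real.pi ^ 2 * r ^ 2)) * expProfile (r ^ 2 / (4 * t)))]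
  · unfold regPropagator
    ring
  · intro t ht
    have ht0 := (hpos t ht).ne'
    have h1 : HasDerivAt (fun t : ℝ => r ^ 2 / (4 * t)) (-(r ^ 2 / (4 * t ^ 2))) t := by
      have := (((hasDerivAt_id t).const_mul 4).inv (by simpa using ht0)).const_mul (r ^ 2)
      refine this.congr_deriv ?_
      simp only [id]
      field_simp
    refine (((hasDerivAt_expProfile _).comp t h1).const_mul
      (-(1 / (4 * Real.pi ^ 2 * r ^ 2)))).congr_deriv ?_
    rw [heatKernelDt, ← hr, ← neg_div]
    have := Real.pi_ne_zero
    field_simp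
    ring
  · refine ContinuousOn.intervalIntegrable fun t ht => ?_
    have ht0 := (hpos t ht).ne'
    unfold heatKernelDt
    refine ContinuousAt.continuousWithinAt ?_
    fun_prop (disch := positivity)

lemma integral_integral_heatKernelDt {ε L : ℝ} (hε : 0 < ε) (hεL : ε ≤ L)
    {x y : EuclideanSpace ℝ (Fin 4)} (hxy : ‖x - y‖ ≠ 0) (c : ℝ) :
    ∫ t₁ in ε..L, ∫ t₂ in ε..L, c * (t₁ * t₂) * heatKernelDt t₁ x y * heatKernelDt t₂ x y =
      c * regPropagator ε L ‖x - y‖ ^ 2 := by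
  have h : ∀ t₁ t₂ : ℝ, c * (t₁ * t₂) * heatKernelDt t₁ x y * heatKernelDt t₂ x y =
      c * (t₁ * heatKernelDt t₁ x y) * (t₂ * heatKernelDt t₂ x y) := fun _ _ => by ring
  simp only [h, intervalIntegral.integral_const_mul, intervalIntegral.integral_mul_const,
    integral_mul_heatKernelDt hε hεL hxy]
  ring

lemma abs_regPropagator_le {ε L r : ℝ} (hε : 0 < ε) (hεL : ε ≤ L) :
    |regPropagator ε L r| ≤ 1 / (Real.pi ^ 2 * r ^ 2) * Real.exp (-r ^ 2 / (8 * L)) := by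
  have hL := hε.trans_le hεL
  have h1 := abs_expProfile_le (s := r ^ 2 / (4 * ε)) (by positivity)
  have h2 := abs_expProfile_le (s := r ^ 2 / (4 * L)) (by positivity)
  have h3 : Real.exp (-(r ^ 2 / (4 * ε)) / 2) ≤ Real.exp (-r ^ 2 / (8 * L)) := by
    rw [Real.exp_le_exp, neg_div, neg_div, neg_le_neg_iff, div_div]
    gcongr r ^ 2 / ?_
    linarith
  have h4 : -(r ^ 2 / (4 * L)) / 2 = -r ^ 2 / (8 * L) := by ring
  rw [h4] at h2
  have h5 := abs_sub (expProfile (r ^ 2 / (4 * ε))) (expProfile (r ^ 2 / (4 * L)))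
  rw [regPropagator, abs_mul, abs_of_nonneg (by positivity)]
  calc _ ≤ 1 / (4 * Real.pi ^ 2 * r ^ 2) * (4 * Real.exp (-r ^ 2 / (8 * L))) := by
        gcongr
        linarith
    _ = _ := by
        rw [show 4 * Real.pi ^ 2 * r ^ 2 = 4 * (Real.pi ^ 2 * r ^ 2) by ring,
          one_div, mul_inv]
        ring

lemma abs_regPropagator_le_const {ε L r : ℝ} (hε : 0 < ε) (hεL : ε ≤ L) (hr : r ≠ 0) :
    |regPropagator ε L r| ≤
      (1 / ε - 1 / L) / (8 * Real.pi ^ 2) * Real.exp (-r ^ 2 / (8 * L)) := by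
  have hL := hε.trans_le hεL
  have h := abs_expProfile_sub_le (u := r ^ 2 / (4 * L)) (v := r ^ 2 / (4 * ε)) (by positivity)
    (by gcongr)
  rw [regPropagator, abs_mul, abs_of_nonneg (by positivity)]
  refine (mul_le_mul_of_nonneg_left h (by positivity)).trans_eq ?_
  rw [show -(r ^ 2 / (4 * L)) / 2 = -r ^ 2 / (8 * L) by ring]
  have := Real.pi_ne_zero
  field_simp
  ring

lemma integrableOn_and_integral_expProfile_sub {a b : ℝ} (ha : 0 < a) (hab : a ≤ b) :
    IntegrableOn (fun y => y⁻¹ * (expProfile (a * y ^ 2) - expProfile (b * y ^ 2))) (Set.Ioi 0) ∧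
    ∫ y in Set.Ioi 0, y⁻¹ * (expProfile (a * y ^ 2) - expProfile (b * y ^ 2)) =
      Real.log (b / a) / 2 := by
  have hb := ha.trans_le hab
  have hint : IntegrableOn
      (fun y => y⁻¹ * (expProfile (a * y ^ 2) - expProfile (b * y ^ 2))) (Set.Ioi 0) := by
    have hdom := ((integrable_mul_exp_neg_mul_sq (b := a / 2) (by positivity)).const_mul
      (2 * (b - a))).integrableOn (s := Set.Ioi 0)
    refine Integrable.mono' hdom ?_ ?_
    · have := continuous_expProfile.measurable
      exact Measurable.aestronglyMeasurable (by fun_prop)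
    · filter_upwards [ae_restrict_mem measurableSet_Ioi] with y (hy : 0 < y)
      have h := abs_expProfile_sub_le (u := a * y ^ 2) (v := b * y ^ 2) (by positivity) (by gcongr)
      rw [Real.norm_eq_abs, abs_mul, abs_of_pos (inv_pos.2 hy), abs_sub_comm]
      refine (mul_le_mul_of_nonneg_left h (by positivity)).trans_eq ?_
      rw [show -(a * y ^ 2) / 2 = -(a / 2) * y ^ 2 by ring]
      field_simp
  refine ⟨hint, ?_⟩
  have hcont : Continuous fun y : ℝ => expProfile (y ^ 2) :=
    continuous_expProfile.comp (by fun_prop)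
  have hL : Tendsto (fun y : ℝ => expProfile (y ^ 2)) (𝓝[>] 0) (𝓝 1) := by
    have := hcont.tendsto 0
    simp only [expProfile, ne_eq, OfNat.ofNat_ne_zero, not_false_eq_true, zero_pow, sub_zero,
      neg_zero, Real.exp_zero, mul_one] at this
    exact this.mono_left nhdsWithin_le_nhds
  have hR : Tendsto (fun y : ℝ => expProfile (y ^ 2)) atTop (𝓝 0) :=
    tendsto_expProfile_atTop.comp (tendsto_pow_atTop two_ne_zero)
  have hsq : ∀ c : ℝ, 0 < c → ∀ y : ℝ, c * y ^ 2 = (√c * y) ^ 2 := fun c hc y => by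
    rw [mul_pow, Real.sq_sqrt hc.le]
  simp only [hsq a ha, hsq b hb] at hint ⊢
  have := Frullani.integral_Ioi_eq (f := fun y : ℝ => expProfile (y ^ 2))
    (hcont.locallyIntegrable.locallyIntegrableOn _) (Real.sqrt_pos.2 ha) (Real.sqrt_pos.2 hb)
    hL hR hint
  simp only [smul_eq_mul, sub_zero, mul_one] at this
  rw [this, ← Real.sqrt_div' _ ha.le, Real.log_sqrt (by positivity)]

lemma integrableOn_pow_three_mul_exp {c : ℝ} (hc : 0 < c) :
    IntegrableOn (fun y : ℝ => y ^ 3 * Real.exp (-c * y ^ 2)) (Set.Ioi 0) := by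
  have h := integrableOn_rpow_mul_exp_neg_mul_sq hc (s := 3) (by norm_num)
  exact_mod_cast h

lemma integral_pow_three_mul_exp {c : ℝ} (hc : 0 < c) :
    ∫ y in Set.Ioi (0 : ℝ), y ^ 3 * Real.exp (-c * y ^ 2) = 1 / (2 * c ^ 2) := by
  have h := integral_rpow_mul_exp_neg_mul_rpow (p := 2) (q := 3) two_pos (by norm_num) hc
  have hG : Real.Gamma ((3 + 1) / 2) = 1 := by norm_num
  have hc2 : c ^ (-((3 : ℝ) + 1) / 2) = (c ^ 2)⁻¹ := by
    rw [show -((3 : ℝ) + 1) / 2 = -(2 : ℕ) by norm_num, Real.rpow_neg hc.le, Real.rpow_natCast]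
  rw [hG, hc2] at h
  norm_cast at h
  rw [h]
  ring

lemma integral_inv_mul_expProfile_sub_sq {p q : ℝ} (hp : 0 < p) (hpq : p ≤ q) :
    ∫ y in Set.Ioi (0 : ℝ), y⁻¹ * (expProfile (q * y ^ 2) - expProfile (p * y ^ 2)) ^ 2 =
      Real.log ((p + q) ^ 2 / (4 * p * q)) / 2 + 1 / 4 - p * q / (p + q) ^ 2 := by
  have hq := hp.trans_le hpq
  obtain ⟨i1, e1⟩ := integrableOn_and_integral_expProfile_sub (a := 2 * p) (b := p + q)
    (by positivity) (by linarith)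
  obtain ⟨i2, e2⟩ := integrableOn_and_integral_expProfile_sub (a := p + q) (b := 2 * q)
    (by positivity) (by linarith)
  have i3 := (integrableOn_pow_three_mul_exp (c := 2 * p) (by positivity)).const_mul (p ^ 2)
  have i4 := (integrableOn_pow_three_mul_exp (c := 2 * q) (by positivity)).const_mul (q ^ 2)
  have i5 := (integrableOn_pow_three_mul_exp (c := p + q) (by positivity)).const_mul (2 * p * q)
  have hsplit : ∀ y ∈ Set.Ioi (0 : ℝ),
      y⁻¹ * (expProfile (q * y ^ 2) - expProfile (p * y ^ 2)) ^ 2 =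
      y⁻¹ * (expProfile (2 * p * y ^ 2) - expProfile ((p + q) * y ^ 2))
      - y⁻¹ * (expProfile ((p + q) * y ^ 2) - expProfile (2 * q * y ^ 2))
      + p ^ 2 * (y ^ 3 * Real.exp (-(2 * p) * y ^ 2))
      + q ^ 2 * (y ^ 3 * Real.exp (-(2 * q) * y ^ 2))
      - 2 * p * q * (y ^ 3 * Real.exp (-(p + q) * y ^ 2)) := by
    intro y (hy : 0 < y)
    have h1 : Real.exp (-(2 * p) * y ^ 2) = Real.exp (-(p * y ^ 2)) ^ 2 := by
      rw [← Real.exp_nat_mul]; push_cast; ring_nf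
    have h2 : Real.exp (-(2 * q) * y ^ 2) = Real.exp (-(q * y ^ 2)) ^ 2 := by
      rw [← Real.exp_nat_mul]; push_cast; ring_nf
    have h3 : Real.exp (-(p + q) * y ^ 2) =
        Real.exp (-(p * y ^ 2)) * Real.exp (-(q * y ^ 2)) := by
      rw [← Real.exp_add]; ring_nf
    simp only [expProfile, ← neg_mul (2 * p), ← neg_mul (2 * q), ← neg_mul (p + q), h1, h2, h3]
    field_simp
    ring
  rw [setIntegral_congr_fun measurableSet_Ioi hsplit,
    integral_sub (((i1.fun_sub i2).fun_add i3).fun_add i4) i5,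
    integral_add ((i1.fun_sub i2).fun_add i3) i4, integral_add (i1.fun_sub i2) i3,
    integral_sub i1 i2,
    e1, e2, integral_const_mul, integral_const_mul, integral_const_mul,
    integral_pow_three_mul_exp (by positivity), integral_pow_three_mul_exp (by positivity),
    integral_pow_three_mul_exp (by positivity)]
  have hlog : Real.log ((p + q) ^ 2 / (4 * p * q)) =
      Real.log ((p + q) / (2 * p)) - Real.log (2 * q / (p + q)) := by
    rw [← Real.log_div (by positivity) (by positivity)]
    congr 1
    field_simp
    ring
  rw [hlog]
  field_simp
  ring

lemma integral_regPropagator_sq {ε L : ℝ} (hε : 0 < ε) (hεL : ε ≤ L) :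
    ∫ z : EuclideanSpace ℝ (Fin 4), regPropagator ε L ‖z‖ ^ 2 =
      1 / (16 * Real.pi ^ 2) *
        (Real.log ((ε + L) ^ 2 / (4 * ε * L)) + 1 / 2 - 2 * (ε * L) / (ε + L) ^ 2) := by
  have hL := hε.trans_le hεL
  have hball : (volume : Measure (EuclideanSpace ℝ (Fin 4))).real (Metric.ball 0 1) =
      Real.pi ^ 2 / 2 := by
    rw [Measure.real, EuclideanSpace.volume_ball]
    have : Real.Gamma (4 / 2 + 1) = 2 := by
      rw [show (4 / 2 + 1 : ℝ) = (2 : ℕ) + 1 by norm_num, Real.Gamma_nat_eq_factorial]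
      norm_num
    have h2 : √Real.pi ^ 4 = Real.pi ^ 2 := by
      rw [show 4 = 2 * 2 by norm_num, pow_mul, Real.sq_sqrt Real.pi_pos.le]
    simp [this, h2]
    positivity
  rw [integral_fun_norm_addHaar volume (fun r => regPropagator ε L r ^ 2), hball,
    finrank_euclideanSpace_fin]
  have hcongr : ∀ y ∈ Set.Ioi (0 : ℝ), y ^ (4 - 1) • regPropagator ε L y ^ 2 =
      1 / (16 * Real.pi ^ 4) *
      (y⁻¹ * (expProfile (1 / (4 * ε) * y ^ 2) - expProfile (1 / (4 * L) * y ^ 2)) ^ 2) := by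
    intro y (hy : 0 < y)
    rw [regPropagator, smul_eq_mul, div_mul_eq_mul_div, div_mul_eq_mul_div, one_mul]
    have := Real.pi_ne_zero
    field_simp
    ring
  rw [setIntegral_congr_fun measurableSet_Ioi hcongr, integral_const_mul,
    integral_inv_mul_expProfile_sub_sq (by positivity) (by gcongr)]
  have harg : (1 / (4 * L) + 1 / (4 * ε)) ^ 2 / (4 * (1 / (4 * L)) * (1 / (4 * ε))) =
      (ε + L) ^ 2 / (4 * ε * L) := by
    field_simp
  rw [harg]
  have := Real.pi_ne_zero
  simp only [nsmul_eq_mul, smul_eq_mul]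
  field_simp
  ring

lemma ae_norm_snd_ne_zero : ∀ᵐ q : EuclideanSpace ℝ (Fin 4) × EuclideanSpace ℝ (Fin 4),
    ‖q.2‖ ≠ 0 := by
  have h : ∀ᵐ z : EuclideanSpace ℝ (Fin 4), z ≠ 0 := by simp [ae_iff]
  filter_upwards [Measure.quasiMeasurePreserving_snd.ae h] with q hq
  exact norm_ne_zero_iff.2 hq

lemma integral_heatKernelDt_eq_shear {ε L : ℝ} (hε : 0 < ε) (hεL : ε ≤ L)
    (φ : EuclideanSpace ℝ (Fin 4) × EuclideanSpace ℝ (Fin 4) → ℝ) :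
    ∫ p : EuclideanSpace ℝ (Fin 4) × EuclideanSpace ℝ (Fin 4),
      ∫ t₁ in ε..L, ∫ t₂ in ε..L,
        φ p * (t₁ * t₂) * heatKernelDt t₁ p.1 p.2 * heatKernelDt t₂ p.1 p.2 =
    ∫ q : EuclideanSpace ℝ (Fin 4) × EuclideanSpace ℝ (Fin 4),
      φ (q.1, q.1 + q.2) * regPropagator ε L ‖q.2‖ ^ 2 := by
  rw [Measure.volume_eq_prod,
    ← (measurePreserving_prod_add (volume : Measure (EuclideanSpace ℝ (Fin 4))) volume).integral_comp
      (MeasurableEquiv.shearAddRight (EuclideanSpace ℝ (Fin 4))).measurableEmbedding]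
  refine integral_congr_ae ?_
  filter_upwards [ae_norm_snd_ne_zero] with q hq
  have h : ‖q.1 - (q.1 + q.2)‖ = ‖q.2‖ := by rw [sub_add_cancel_left, norm_neg]
  rw [integral_integral_heatKernelDt hε hεL (by rwa [h]), h]

lemma integrable_regPropagator_sq {ε L : ℝ} (hε : 0 < ε) (hεL : ε ≤ L) :
    Integrable fun z : EuclideanSpace ℝ (Fin 4) => regPropagator ε L ‖z‖ ^ 2 := by
  have hL := hε.trans_le hεL
  rw [integrable_fun_norm_addHaar volume (f := fun r => regPropagator ε L r ^ 2),
    finrank_euclideanSpace_fin]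
  have hdom := (integrableOn_pow_three_mul_exp (c := 1 / (4 * L)) (by positivity)).const_mul
    (((1 / ε - 1 / L) / (8 * Real.pi ^ 2)) ^ 2)
  refine Integrable.mono' hdom ?_ ?_
  · have := measurable_regPropagator ε L
    exact Measurable.aestronglyMeasurable (by fun_prop)
  · filter_upwards [ae_restrict_mem measurableSet_Ioi] with y (hy : 0 < y)
    have h := abs_regPropagator_le_const hε hεL hy.ne'
    have h2 : Real.exp (-(1 / (4 * L)) * y ^ 2) = Real.exp (-y ^ 2 / (8 * L)) ^ 2 := by
      rw [← Real.exp_nat_mul]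
      congr 1
      push_cast
      field_simp
      norm_num
    rw [smul_eq_mul, Real.norm_eq_abs, abs_mul, abs_of_pos (by positivity), abs_pow, h2]
    refine (mul_le_mul_of_nonneg_left (pow_le_pow_left₀ (abs_nonneg _) h 2)
      (by positivity)).trans_eq ?_
    ring

lemma integrable_inv_norm_pow_three_mul_exp {c : ℝ} (hc : 0 < c) :
    Integrable fun z : EuclideanSpace ℝ (Fin 4) =>
      (‖z‖ ^ 3)⁻¹ * Real.exp (-c * ‖z‖ ^ 2) := by
  rw [integrable_fun_norm_addHaar volume (f := fun r => (r ^ 3)⁻¹ * Real.exp (-c * r ^ 2)),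
    finrank_euclideanSpace_fin]
  refine (integrable_exp_neg_mul_sq hc).integrableOn.congr_fun (fun y (hy : 0 < y) => ?_)
    measurableSet_Ioi
  simp only [smul_eq_mul]
  field_simp

lemma tendsto_regPropagator {L r : ℝ} (hr : r ≠ 0) :
    Tendsto (fun ε => regPropagator ε L r) (𝓝[>] 0)
      (𝓝 (1 / (4 * Real.pi ^ 2 * r ^ 2) * (0 - expProfile (r ^ 2 / (4 * L))))) := by
  have h : Tendsto (fun ε : ℝ => r ^ 2 / (4 * ε)) (𝓝[>] 0) atTop := by
    have := tendsto_inv_nhdsGT_zero.const_mul_atTop (r := r ^ 2 / 4) (by positivity)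
    refine this.congr fun ε => ?_
    rw [← div_div, div_eq_mul_inv (r ^ 2 / 4)]
  exact ((tendsto_expProfile_atTop.comp h).sub_const _).const_mul _

/-- After subtracting the restriction of `φ` to the diagonal, the integrand is dominated
uniformly in `ε`. -/
lemma exists_integrable_bound_sub_diagonal_mul_regPropagator_sq {L : ℝ} (hL : 0 < L)
    {φ : EuclideanSpace ℝ (Fin 4) × EuclideanSpace ℝ (Fin 4) → ℝ}
    (hφ : ContDiff ℝ (⊤ : ℕ∞) φ) (hφc : HasCompactSupport φ) :
    ∃ B : EuclideanSpace ℝ (Fin 4) × EuclideanSpace ℝ (Fin 4) → ℝ, Integrable B ∧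
      ∀ ε, 0 < ε → ε ≤ L → ∀ q, ‖q.2‖ ≠ 0 →
        ‖(φ (q.1, q.1 + q.2) - φ (q.1, q.1)) * regPropagator ε L ‖q.2‖ ^ 2‖ ≤ B q := by
  obtain ⟨C, hC⟩ := hφ.lipschitzWith_of_hasCompactSupport hφc (by simp)
  set K := Prod.fst '' tsupport φ with hK
  have hKc : IsCompact K := hφc.isCompact.image continuous_fst
  have hind : Integrable (K.indicator fun _ => (C : ℝ) / Real.pi ^ 4) :=
    (integrable_indicator_iff hKc.measurableSet).2
      (integrableOn_const hKc.measure_lt_top.ne)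
  refine ⟨_, hind.mul_prod (integrable_inv_norm_pow_three_mul_exp (c := 1 / (4 * L))
    (by positivity)), fun ε hε hεL q hq => ?_⟩
  by_cases hqK : q.1 ∈ K
  · have h := abs_regPropagator_le (r := ‖q.2‖) hε hεL
    have h1 : |φ (q.1, q.1 + q.2) - φ (q.1, q.1)| ≤ C * ‖q.2‖ := by
      have := hC.dist_le_mul (q.1, q.1 + q.2) (q.1, q.1)
      simpa [Prod.dist_eq, Real.dist_eq] using this
    have h2 : Real.exp (-(1 / (4 * L)) * ‖q.2‖ ^ 2) =
        Real.exp (-‖q.2‖ ^ 2 / (8 * L)) ^ 2 := by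
      rw [← Real.exp_nat_mul]
      congr 1
      push_cast
      field_simp
      norm_num
    rw [Set.indicator_of_mem hqK, h2, Real.norm_eq_abs, abs_mul, abs_pow]
    refine (mul_le_mul h1 (pow_le_pow_left₀ (abs_nonneg _) h 2) (by positivity)
      (by positivity)).trans_eq ?_
    have := Real.pi_ne_zero
    field_simp
  · have h0 : ∀ y, φ (q.1, y) = 0 := fun y =>
      image_eq_zero_of_notMem_tsupport fun h => hqK ⟨_, h, rfl⟩
    simp [h0, Set.indicator_of_notMem hqK]

lemma integrable_diagonal
    {φ : EuclideanSpace ℝ (Fin 4) × EuclideanSpace ℝ (Fin 4) → ℝ}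
    (hφ : Continuous φ) (hφc : HasCompactSupport φ) :
    Integrable fun x : EuclideanSpace ℝ (Fin 4) => φ (x, x) := by
  refine Continuous.integrable_of_hasCompactSupport (by fun_prop) ?_
  refine HasCompactSupport.intro (hφc.isCompact.image continuous_fst) fun x hx => ?_
  exact image_eq_zero_of_notMem_tsupport fun h => hx ⟨_, h, rfl⟩

lemma aestronglyMeasurable_sub_diagonal_mul_regPropagator_sq (ε L : ℝ)
    {φ : EuclideanSpace ℝ (Fin 4) × EuclideanSpace ℝ (Fin 4) → ℝ} (hφ : Continuous φ) :
    AEStronglyMeasurable fun q : EuclideanSpace ℝ (Fin 4) × EuclideanSpace ℝ (Fin 4) =>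
      (φ (q.1, q.1 + q.2) - φ (q.1, q.1)) * regPropagator ε L ‖q.2‖ ^ 2 := by
  have h1 := measurable_regPropagator ε L
  have h2 := hφ.measurable
  exact Measurable.aestronglyMeasurable (by fun_prop)

lemma tendsto_log_add_log {L : ℝ} (hL : 0 < L) :
    Tendsto (fun ε : ℝ => Real.log ((ε + L) ^ 2 / (4 * ε * L)) + 1 / 2
        - 2 * (ε * L) / (ε + L) ^ 2 + Real.log ε) (𝓝[>] 0)
      (𝓝 (Real.log ((0 + L) ^ 2 / (4 * L)) + 1 / 2 - 2 * (0 * L) / (0 + L) ^ 2)) := by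
  have hc : ContinuousAt (fun ε : ℝ => Real.log ((ε + L) ^ 2 / (4 * L)) + 1 / 2
      - 2 * (ε * L) / (ε + L) ^ 2) 0 := by
    have h1 : (0 + L) ^ 2 / (4 * L) ≠ 0 := by positivity
    have h2 : (0 + L) ^ 2 ≠ 0 := by positivity
    fun_prop (disch := assumption)
  refine (hc.tendsto.mono_left nhdsWithin_le_nhds).congr' ?_
  filter_upwards [self_mem_nhdsWithin] with ε (hε : 0 < ε)
  have : (ε + L) ^ 2 / (4 * L) = (ε + L) ^ 2 / (4 * ε * L) * ε := by field_simp
  rw [this, Real.log_mul (by positivity) hε.ne']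
  ring

/-- The regularized one-loop weight with two `t·∂_t`-propagators has logarithmic singular
part `-(1/(16π²)) (∫ φ(x,x) dx) · log ε` as `ε → 0⁺`. -/
theorem log_divergence_tt
    (L : ℝ) (hL : 0 < L)
    (φ : EuclideanSpace ℝ (Fin 4) × EuclideanSpace ℝ (Fin 4) → ℝ)
    (hφ : ContDiff ℝ (⊤ : ℕ∞) φ) (hφc : HasCompactSupport φ) :
    ∃ c : ℝ, Filter.Tendsto
      (fun ε : ℝ =>
        (∫ p : EuclideanSpace ℝ (Fin 4) × EuclideanSpace ℝ (Fin 4),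
          ∫ t₁ in ε..L, ∫ t₂ in ε..L,
            φ p * (t₁ * t₂) * heatKernelDt t₁ p.1 p.2 * heatKernelDt t₂ p.1 p.2) +
        (1 / (16 * Real.pi ^ 2)) *
          (∫ x : EuclideanSpace ℝ (Fin 4), φ (x, x)) * Real.log ε)
      (𝓝[>] 0) (𝓝 c) := by
  obtain ⟨B, hB, hbound⟩ := exists_integrable_bound_sub_diagonal_mul_regPropagator_sq hL hφ hφc
  have hmeas := fun ε => aestronglyMeasurable_sub_diagonal_mul_regPropagator_sq ε L hφ.continuous
  have hev : ∀ᶠ ε : ℝ in 𝓝[>] 0, 0 < ε ∧ ε ≤ L := by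
    filter_upwards [Ioc_mem_nhdsGT hL] with ε hε using hε
  have hrem := tendsto_integral_filter_of_dominated_convergence B
    (Eventually.of_forall hmeas)
    (by
      filter_upwards [hev] with ε hε
      filter_upwards [ae_norm_snd_ne_zero] with q hq using hbound ε hε.1 hε.2 q hq) hB
    (by
      filter_upwards [ae_norm_snd_ne_zero] with q hq
      exact ((tendsto_regPropagator (L := L) hq).pow 2).const_mul
        (φ (q.1, q.1 + q.2) - φ (q.1, q.1)))
  refine ⟨_, (hrem.add ((tendsto_log_add_log hL).const_mul
    (1 / (16 * Real.pi ^ 2) * ∫ x : EuclideanSpace ℝ (Fin 4), φ (x, x)))).congr' ?_⟩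
  filter_upwards [hev] with ε ⟨hε, hεL⟩
  have hint1 : Integrable fun q : EuclideanSpace ℝ (Fin 4) × EuclideanSpace ℝ (Fin 4) =>
      (φ (q.1, q.1 + q.2) - φ (q.1, q.1)) * regPropagator ε L ‖q.2‖ ^ 2 := by
    refine hB.mono' (hmeas ε) ?_
    filter_upwards [ae_norm_snd_ne_zero] with q hq using hbound ε hε hεL q hq
  have hint2 := (integrable_diagonal hφ.continuous hφc).mul_prod
    (integrable_regPropagator_sq hε hεL)
  have hsplit : ∀ q : EuclideanSpace ℝ (Fin 4) × EuclideanSpace ℝ (Fin 4),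
      φ (q.1, q.1 + q.2) * regPropagator ε L ‖q.2‖ ^ 2 =
      (φ (q.1, q.1 + q.2) - φ (q.1, q.1)) * regPropagator ε L ‖q.2‖ ^ 2 +
        φ (q.1, q.1) * regPropagator ε L ‖q.2‖ ^ 2 := fun q => by ring
  have hprod : ∫ q : EuclideanSpace ℝ (Fin 4) × EuclideanSpace ℝ (Fin 4),
      φ (q.1, q.1) * regPropagator ε L ‖q.2‖ ^ 2 =
      (∫ x : EuclideanSpace ℝ (Fin 4), φ (x, x)) *
        ∫ z : EuclideanSpace ℝ (Fin 4), regPropagator ε L ‖z‖ ^ 2 :=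
    integral_prod_mul (fun x => φ (x, x)) fun z => regPropagator ε L ‖z‖ ^ 2
  rw [integral_heatKernelDt_eq_shear hε hεL, integral_congr_ae (ae_of_all _ hsplit),
    integral_add hint1 hint2, hprod, integral_regPropagator_sq hε hεL]
  ring
end

section
/- Fix L > 0. Then the function ε ↦ ∫_ε^L ∫_ε^L t₂/(t₁+t₂)³ dt₁ dt₂ + (1/2)·log ε converges to a finite limit as ε → 0⁺; that is, the double integral ∫_ε^L ∫_ε^L t₂/(t₁+t₂)³ dt₁ dt₂ has logarithmic singular part −(1/2)·log ε. -/
open MeasureTheory Filter Topology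

lemma integral_div_add_pow_three {a x y : ℝ} (ha : 0 < a) (hx : 0 < x) (hy : 0 < y) :
    ∫ t in x..y, t / (a + t) ^ 3 =
      y ^ 2 / (2 * a * (a + y) ^ 2) - x ^ 2 / (2 * a * (a + x) ^ 2) := by
  have hpos : ∀ t ∈ Set.uIcc x y, 0 < a + t := fun t ht =>
    add_pos ha ((lt_min hx hy).trans_le ht.1)
  refine intervalIntegral.integral_eq_sub_of_hasDerivAt
    (f := fun t => t ^ 2 / (2 * a * (a + t) ^ 2)) (fun t ht => ?_) ?_
  · have h := hpos t ht
    refine ((hasDerivAt_pow 2 t).div ((((hasDerivAt_id t).const_add a).pow 2).const_mul (2 * a))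
      (by simp only [id, Pi.pow_apply]; positivity)).congr_deriv ?_
    simp only [id, Pi.pow_apply]
    field_simp
    ring
  · apply ContinuousOn.intervalIntegrable
    exact continuousOn_id.div (by fun_prop) fun t ht => (pow_pos (hpos t ht) 3).ne'

lemma integral_sq_div_sub_sq_div {x y : ℝ} (hx : 0 < x) (hy : 0 < y) :
    ∫ a in x..y, (y ^ 2 / (2 * a * (a + y) ^ 2) - x ^ 2 / (2 * a * (a + x) ^ 2)) =
      Real.log (x + y) - (Real.log (2 * x) + Real.log (2 * y)) / 2 := by
  have hpos : ∀ a ∈ Set.uIcc x y, 0 < a := fun a ha => (lt_min hx hy).trans_le ha.1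
  rw [intervalIntegral.integral_eq_sub_of_hasDerivAt
    (f := fun a => 1 / 2 * (Real.log (a + x) - Real.log (a + y) + y / (a + y) - x / (a + x)))
    (fun a ha => ?_) ?_]
  · have := (add_pos hx hy).ne'
    rw [add_comm y x, ← two_mul, ← two_mul]
    field_simp
    ring
  · apply ContinuousOn.intervalIntegrable
    refine ContinuousOn.sub (continuousOn_const.div (by fun_prop) fun a ha => ?_)
      (continuousOn_const.div (by fun_prop) fun a ha => ?_)
    all_goals
      have := hpos a ha
      positivity
  · have h := hpos a ha
    have hax : a + x ≠ 0 := by positivity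
    have hay : a + y ≠ 0 := by positivity
    have dx : HasDerivAt (fun a => a + x) 1 a := (hasDerivAt_id a).add_const x
    have dy : HasDerivAt (fun a => a + y) 1 a := (hasDerivAt_id a).add_const y
    refine (((((dx.log hax).sub (dy.log hay)).add ((hasDerivAt_const a y).div dy hay)).sub
      ((hasDerivAt_const a x).div dx hax)).const_mul (1 / 2)).congr_deriv ?_
    field_simp
    ring

/-- The double integral `∫_ε^L ∫_ε^L t₂/(t₁+t₂)³ dt₁ dt₂` has logarithmic singular part
`-(1/2)·log ε` as `ε → 0⁺`. -/
theorem t_integral_xt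
    (L : ℝ) (hL : 0 < L) :
    ∃ c : ℝ, Filter.Tendsto
      (fun ε : ℝ =>
        (∫ t₁ in ε..L, ∫ t₂ in ε..L, t₂ / (t₁ + t₂) ^ 3) + (1 / 2) * Real.log ε)
      (𝓝[>] 0) (𝓝 c) := by
  refine ⟨Real.log (0 + L) - (Real.log 2 + Real.log (2 * L)) / 2, ?_⟩
  have hcont : ContinuousAt
      (fun ε : ℝ => Real.log (ε + L) - (Real.log 2 + Real.log (2 * L)) / 2) 0 :=
    ((continuousAt_id.add continuousAt_const).log (by simpa using hL.ne')).sub continuousAt_const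
  refine (hcont.tendsto.mono_left nhdsWithin_le_nhds).congr' ?_
  filter_upwards [self_mem_nhdsWithin] with ε (hε : 0 < ε)
  rw [intervalIntegral.integral_congr fun a ha =>
      integral_div_add_pow_three ((lt_min hε hL).trans_le ha.1) hε hL,
    integral_sq_div_sub_sq_div hε hL, Real.log_mul two_ne_zero hε.ne']
  ring
end

section
/- Fix L > 0. Then the function ε ↦ ∫_ε^L ∫_ε^L t₁t₂/(t₁+t₂)⁴ dt₁ dt₂ + (1/6)·log ε converges to a finite limit as ε → 0⁺; that is, the double integral ∫_ε^L ∫_ε^L t₁t₂/(t₁+t₂)⁴ dt₁ dt₂ has logarithmic singular part −(1/6)·log ε. -/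
open MeasureTheory Filter Topology

/-- A primitive of `t ↦ s * t / (s + t) ^ 4`. -/
noncomputable def innerPrimitive (s t : ℝ) : ℝ :=
  -s / (2 * (s + t) ^ 2) + s ^ 2 / (3 * (s + t) ^ 3)

/-- A primitive of `s ↦ innerPrimitive s t`. -/
noncomputable def outerPrimitive (s t : ℝ) : ℝ :=
  -(1 / 6) * Real.log (s + t) + t / (6 * (s + t)) - t ^ 2 / (6 * (s + t) ^ 2)

lemma hasDerivAt_innerPrimitive {s t : ℝ} (h : s + t ≠ 0) :
    HasDerivAt (innerPrimitive s) (s * t / (s + t) ^ 4) t := by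
  have hu : HasDerivAt (fun x : ℝ => s + x) 1 t := (hasDerivAt_id t).const_add s
  have h₁ := (hasDerivAt_const t (-s)).fun_div ((hu.fun_pow 2).const_mul 2) (by positivity)
  have h₂ := (hasDerivAt_const t (s ^ 2)).fun_div ((hu.fun_pow 3).const_mul 3) (by positivity)
  refine (h₁.fun_add h₂).congr_deriv ?_
  field_simp
  ring

lemma hasDerivAt_outerPrimitive {s t : ℝ} (h : s + t ≠ 0) :
    HasDerivAt (fun x => outerPrimitive x t) (innerPrimitive s t) s := by
  have hu : HasDerivAt (fun x : ℝ => x + t) 1 s := (hasDerivAt_id s).add_const t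
  have h₀ := (hu.log h).const_mul (-(1 / 6))
  have h₁ := (hasDerivAt_const s t).fun_div (hu.const_mul 6) (by positivity)
  have h₂ := (hasDerivAt_const s (t ^ 2)).fun_div ((hu.fun_pow 2).const_mul 6) (by positivity)
  refine ((h₀.fun_add h₁).fun_sub h₂).congr_deriv ?_
  unfold innerPrimitive
  field_simp
  ring

lemma integral_innerPrimitive {a b t : ℝ} (ha : 0 < a) (hb : 0 < b) (ht : 0 < t) :
    IntervalIntegrable (fun s => innerPrimitive s t) volume a b ∧
      ∫ s in a..b, innerPrimitive s t = outerPrimitive b t - outerPrimitive a t := by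
  have pos : ∀ s ∈ Set.uIcc a b, 0 < s + t := fun s hs =>
    add_pos ((lt_min ha hb).trans_le hs.1) ht
  have hint : IntervalIntegrable (fun s => innerPrimitive s t) volume a b := by
    refine ContinuousOn.intervalIntegrable fun s hs => ContinuousAt.continuousWithinAt ?_
    have := pos s hs
    unfold innerPrimitive
    fun_prop (disch := positivity)
  exact ⟨hint, intervalIntegral.integral_eq_sub_of_hasDerivAt
    (fun s hs => hasDerivAt_outerPrimitive (pos s hs).ne') hint⟩

lemma integral_mul_div_add_pow_four {a b s : ℝ} (ha : 0 < a) (hb : 0 < b) (hs : 0 < s) :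
    ∫ t in a..b, s * t / (s + t) ^ 4 = innerPrimitive s b - innerPrimitive s a := by
  have pos : ∀ t ∈ Set.uIcc a b, 0 < s + t := fun t ht =>
    add_pos hs ((lt_min ha hb).trans_le ht.1)
  refine intervalIntegral.integral_eq_sub_of_hasDerivAt
    (fun t ht => hasDerivAt_innerPrimitive (pos t ht).ne') ?_
  refine ContinuousOn.intervalIntegrable fun t ht => ContinuousAt.continuousWithinAt ?_
  have := pos t ht
  fun_prop (disch := positivity)

lemma integral_integral_mul_div_add_pow_four {a b : ℝ} (ha : 0 < a) (hb : 0 < b) :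
    ∫ s in a..b, ∫ t in a..b, s * t / (s + t) ^ 4 =
      (outerPrimitive b b - outerPrimitive a b) -
        (outerPrimitive b a - outerPrimitive a a) := by
  have h : Set.EqOn (fun s => ∫ t in a..b, s * t / (s + t) ^ 4)
      (fun s => innerPrimitive s b - innerPrimitive s a) (Set.uIcc a b) := fun s hs =>
    integral_mul_div_add_pow_four ha hb ((lt_min ha hb).trans_le hs.1)
  obtain ⟨hib, hb'⟩ := integral_innerPrimitive ha hb hb
  obtain ⟨hia, ha'⟩ := integral_innerPrimitive ha hb ha
  rw [intervalIntegral.integral_congr h, intervalIntegral.integral_sub hib hia, hb', ha']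

lemma outerPrimitive_self {a : ℝ} (ha : 0 < a) :
    outerPrimitive a a = -(1 / 6) * Real.log a - (1 / 6) * Real.log 2 + 1 / 24 := by
  unfold outerPrimitive
  rw [← two_mul, Real.log_mul two_ne_zero ha.ne']
  field_simp
  ring

/-- The double integral `∫_ε^L ∫_ε^L t₁t₂/(t₁+t₂)⁴ dt₁ dt₂` has logarithmic singular part
`-(1/6)·log ε` as `ε → 0⁺`. -/
theorem t_integral_xx
    (L : ℝ) (hL : 0 < L) :
    ∃ c : ℝ, Filter.Tendsto
      (fun ε : ℝ =>
        (∫ t₁ in ε..L, ∫ t₂ in ε..L, t₁ * t₂ / (t₁ + t₂) ^ 4) + (1 / 6) * Real.log ε)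
      (𝓝[>] 0) (𝓝 c) := by
  have hcont : ContinuousAt (fun ε : ℝ => (outerPrimitive L L - outerPrimitive ε L) -
      (outerPrimitive L ε - (1 / 24 - (1 / 6) * Real.log 2))) 0 := by
    unfold outerPrimitive
    fun_prop (disch := positivity)
  refine ⟨_, (hcont.tendsto.mono_left nhdsWithin_le_nhds).congr' ?_⟩
  filter_upwards [self_mem_nhdsWithin] with ε hε
  rw [integral_integral_mul_div_add_pow_four hε hL, outerPrimitive_self (a := ε) hε]
  ring
end

section
/- Fix L > 0. Then the function ε ↦ ∫_ε^L ∫_ε^L t₁²/(t₁+t₂)⁴ dt₁ dt₂ + (1/3)·log ε converges to a finite limit as ε → 0⁺; that is, the double integral ∫_ε^L ∫_ε^L t₁²/(t₁+t₂)⁴ dt₁ dt₂ has logarithmic singular part −(1/3)·log ε. -/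
open MeasureTheory Filter Topology

lemma integral_sq_div_add_pow_four {ε L t : ℝ} (hε : 0 < ε) (hL : 0 < L) (ht : 0 < t) :
    ∫ s in ε..L, t ^ 2 / (t + s) ^ 4 =
      (1 / 3) * (t ^ 2 / (t + ε) ^ 3) - (1 / 3) * (t ^ 2 / (t + L) ^ 3) := by
  have hpos : ∀ s ∈ Set.uIcc ε L, 0 < t + s := fun s hs =>
    add_pos ht ((lt_min hε hL).trans_le hs.1)
  have hderiv : ∀ s ∈ Set.uIcc ε L,
      HasDerivAt (fun s => -(1 / 3) * (t ^ 2 / (t + s) ^ 3)) (t ^ 2 / (t + s) ^ 4) s := by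
    intro s hs
    have hne := (hpos s hs).ne'
    have h := (((hasDerivAt_const s (t ^ 2)).div (((hasDerivAt_id' s).const_add t).pow 3)
      (pow_ne_zero 3 hne)).const_mul (-(1 / 3)))
    refine h.congr_deriv ?_
    simp only [Pi.pow_apply]
    field_simp
    ring
  rw [intervalIntegral.integral_eq_sub_of_hasDerivAt hderiv]
  · ring
  · refine ContinuousOn.intervalIntegrable (continuousOn_const.div (by fun_prop) ?_)
    exact fun s hs => pow_ne_zero 4 (hpos s hs).ne'

lemma intervalIntegrable_sq_div_add_pow_three {a ε L : ℝ} (hε : 0 < ε) (hL : 0 < L)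
    (ha : 0 < a) : IntervalIntegrable (fun t => t ^ 2 / (t + a) ^ 3) volume ε L := by
  refine ContinuousOn.intervalIntegrable (ContinuousOn.div (by fun_prop) (by fun_prop) ?_)
  exact fun t ht => pow_ne_zero 3 (add_pos ((lt_min hε hL).trans_le ht.1) ha).ne'

lemma integral_sq_div_add_pow_three {a ε L : ℝ} (hε : 0 < ε) (hL : 0 < L) (ha : 0 < a) :
    ∫ t in ε..L, t ^ 2 / (t + a) ^ 3 =
      (Real.log (L + a) + 2 * a / (L + a) - a ^ 2 / (2 * (L + a) ^ 2)) -
      (Real.log (ε + a) + 2 * a / (ε + a) - a ^ 2 / (2 * (ε + a) ^ 2)) := by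
  refine intervalIntegral.integral_eq_sub_of_hasDerivAt
    (f := fun t => Real.log (t + a) + 2 * a / (t + a) - a ^ 2 / (2 * (t + a) ^ 2)) ?_
    (intervalIntegrable_sq_div_add_pow_three hε hL ha)
  intro t ht
  have hne : t + a ≠ 0 := (add_pos ((lt_min hε hL).trans_le ht.1) ha).ne'
  have hadd := (hasDerivAt_id' t).add_const a
  have h := ((hadd.log hne).add ((hasDerivAt_const t (2 * a)).div hadd hne)).sub
    ((hasDerivAt_const t (a ^ 2)).div ((hadd.pow 2).const_mul 2)
      (mul_ne_zero two_ne_zero (pow_ne_zero 2 hne)))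
  refine h.congr_deriv ?_
  simp only [Pi.pow_apply]
  field_simp
  ring

/-- The double integral `∫_ε^L ∫_ε^L t₁²/(t₁+t₂)⁴ dt₁ dt₂` has logarithmic singular part
`-(1/3)·log ε` as `ε → 0⁺`. -/
theorem t_integral_mixed
    (L : ℝ) (hL : 0 < L) :
    ∃ c : ℝ, Filter.Tendsto
      (fun ε : ℝ =>
        (∫ t₁ in ε..L, ∫ t₂ in ε..L, t₁ ^ 2 / (t₁ + t₂) ^ 4) + (1 / 3) * Real.log ε)
      (𝓝[>] 0) (𝓝 c) := by
  let g : ℝ → ℝ := fun ε => (1 / 3) *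
    ((Real.log (L + ε) + 2 * ε / (L + ε) - ε ^ 2 / (2 * (L + ε) ^ 2)) -
      (Real.log 2 + 7 / 8) -
      (Real.log (L + L) + 2 * L / (L + L) - L ^ 2 / (2 * (L + L) ^ 2)) +
      (Real.log (ε + L) + 2 * L / (ε + L) - L ^ 2 / (2 * (ε + L) ^ 2)))
  have hg : ContinuousAt g 0 := by
    have h₁ : L + 0 ≠ 0 := by simpa using hL.ne'
    have h₂ : 0 + L ≠ 0 := by simpa using hL.ne'
    have h₃ : 2 * (L + 0) ^ 2 ≠ 0 := by positivity
    have h₄ : 2 * (0 + L) ^ 2 ≠ 0 := by positivity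
    fun_prop (disch := assumption)
  refine ⟨g 0, (hg.tendsto.mono_left nhdsWithin_le_nhds).congr' ?_⟩
  filter_upwards [self_mem_nhdsWithin] with ε hε
  have hε : 0 < ε := hε
  have hinner : ∫ t₁ in ε..L, ∫ t₂ in ε..L, t₁ ^ 2 / (t₁ + t₂) ^ 4 =
      ∫ t in ε..L, ((1 / 3) * (t ^ 2 / (t + ε) ^ 3) - (1 / 3) * (t ^ 2 / (t + L) ^ 3)) :=
    intervalIntegral.integral_congr fun t ht =>
      integral_sq_div_add_pow_four hε hL ((lt_min hε hL).trans_le ht.1)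
  rw [hinner, intervalIntegral.integral_sub
      ((intervalIntegrable_sq_div_add_pow_three hε hL hε).const_mul _)
      ((intervalIntegrable_sq_div_add_pow_three hε hL hL).const_mul _),
    intervalIntegral.integral_const_mul, intervalIntegral.integral_const_mul,
    integral_sq_div_add_pow_three hε hL hε, integral_sq_div_add_pow_three hε hL hL,
    ← two_mul ε, Real.log_mul two_ne_zero hε.ne']
  have h₁ : 2 * ε / (2 * ε) = 1 := div_self (by positivity)
  have h₂ : ε ^ 2 / (2 * (2 * ε) ^ 2) = 1 / 8 := by field_simp; norm_num
  rw [h₁, h₂]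
  simp only [g]
  ring
end
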